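/- arXiv:2001.11058 — 3 statements merged into one kernel-verified Lean document; each statement's English description precedes it below -/
import Mathlib

section
/- Silver's Dichotomy: Suppose that E is a coanalytic (Π¹₁) equivalence relation on a Borel set X ⊆ 2^ω (Cantor space). Then either E has at most countably many equivalence classes, or there exists a perfect set P ⊆ X whose elements are pairwise E-inequivalent (a perfect partial E-transversal). -/
open MeasureTheory

abbrev Cantor : Type := ℕ → Bool

/-- The equivalence relation `E₀`: eventual agreement. -/
def eZero (x y : Cantor) : Prop := {k | x k ≠ y k}.Finite

/-- The equivalence relation `Eₑ`: the set of disagreements is finite with even cardinality. -/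
def eEven (x y : Cantor) : Prop := {k | x k ≠ y k}.Finite ∧ Even ({k | x k ≠ y k}.ncard)

/-- A set is coanalytic (`Π¹₁`) iff its complement is analytic. -/
def IsCoanalytic {α : Type*} [TopologicalSpace α] (S : Set α) : Prop := AnalyticSet Sᶜ

/-- A perfect set: nonempty, closed, no isolated points. -/
def PerfectSet (X : Set Cantor) : Prop := Perfect X ∧ X.Nonempty

/-- `E` restricted to the Borel set `X` is smooth. -/
def RelSmoothOn (E : Cantor → Cantor → Prop) (X : Set Cantor) : Prop :=
  ∃ f : X → Cantor, Measurable f ∧ ∀ x y : X, (E x y ↔ f x = f y)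

/-- A Borel set is `E₀`-large iff `E₀` restricted to it is not smooth. -/
def E0Large (X : Set Cantor) : Prop := ¬ RelSmoothOn eZero X

/-- An `E₀`-array: strings `u n i` with equal positive lengths and `u n 0 ≠ u n 1`. -/
structure E0Array where
  u : ℕ → Bool → List Bool
  len_eq : ∀ n, (u n false).length = (u n true).length
  len_pos : ∀ n, 1 ≤ (u n false).length
  ne : ∀ n, u n false ≠ u n true

/-- The point `x_u^a = u 0 (a 0) ⌢ u 1 (a 1) ⌢ ⋯`. (Since every block has length
at least one, the join of the first `m+1` blocks has length `> m`.) -/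
def xua (U : E0Array) (a : Cantor) : Cantor := fun m =>
  (((List.range (m + 1)).map (fun n => U.u n (a n))).flatten).getD m false

/-- The canonical `E₀`-large set `D_u` determined by the array `u`. -/
def Du (U : E0Array) : Set Cantor := Set.range (xua U)

/-- A double-bubble system. -/
structure DBS (D E : Cantor → Cantor → Prop) : Prop where
  equivD : Equivalence D
  equivE : Equivalence E
  borelD : MeasurableSet {p : Cantor × Cantor | D p.1 p.2}
  borelE : MeasurableSet {p : Cantor × Cantor | E p.1 p.2}
  countableD : ∀ x, {y | D x y}.Countable
  countableE : ∀ x, {y | E x y}.Countable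
  sub : ∀ x y, D x y → E x y
  double : ∀ x, ∃ y, E x y ∧ ¬ D x y ∧ ∀ z, E x z → (D x z ∨ D y z)

/-- `⟨D,E⟩ ⊑ ⟨D',E'⟩`: extension of double-bubble systems. -/
def DBSle (D E D' E' : Cantor → Cantor → Prop) : Prop :=
  (∀ x y, D x y → D' x y) ∧ (∀ x y, E x y → E' x y) ∧
    (∀ x y, E x y → ¬ D x y → ¬ D' x y)

open Filter Topology Set
open PiNat (res res_succ res_length res_eq_res cylinder_eq_res cylinder_anti mem_cylinder_iff_eq
  self_mem_cylinder update_mem_cylinder isOpen_cylinder isTopologicalBasis_cylinders cylinder_eq_pi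
  firstDiff apply_firstDiff_ne)

theorem tendsto_of_eventually_agree {α : Type*} [TopologicalSpace α] {b : ℕ → ℕ → α} {z : ℕ → α}
    (h : ∀ n, ∀ i < n, b n i = z i) : Tendsto b atTop (𝓝 z) := by
  refine tendsto_pi_nhds.2 fun i => tendsto_const_nhds.congr' ?_
  filter_upwards [eventually_gt_atTop i] with n hn using (h n i hn).symm

/-- A scheme of sets indexed by finite binary strings (latest digit first), whose members at level
`n` agree on their first `n` coordinates, induces a continuous map on Cantor space. -/
theorem exists_continuous_of_scheme {α : Type*} [TopologicalSpace α] [DiscreteTopology α]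
    (B : ℕ → List Bool → Set (ℕ → α)) (hne : ∀ x n, (B n (res x n)).Nonempty)
    (hanti : ∀ n i s, B (n + 1) (i :: s) ⊆ B n s)
    (hagree : ∀ x n, ∀ b ∈ B n (res x n), ∀ c ∈ B n (res x n), ∀ i < n, b i = c i) :
    ∃ g : Cantor → ℕ → α, Continuous g ∧ ∀ x n, ∀ b ∈ B n (res x n), ∀ i < n, b i = g x i := by
  choose b hb using hne
  have hmono : ∀ x m n, m ≤ n → B n (res x n) ⊆ B m (res x m) := by
    intro x m n hmn
    induction n, hmn using Nat.le_induction with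
    | base => exact subset_rfl
    | succ n _ ih => exact (hanti n (x n) (res x n)).trans ih
  refine ⟨fun x i => b x (i + 1) i, ?_, fun x n c hc i hi =>
    hagree x (i + 1) c (hmono x _ _ hi hc) _ (hb x _) i i.lt_succ_self⟩
  refine continuous_pi fun i => continuous_iff_continuousAt.2 fun x => ?_
  have hmem : PiNat.cylinder x (i + 1) ∈ 𝓝 x :=
    (isOpen_cylinder _ x (i + 1)).mem_nhds (self_mem_cylinder x _)
  refine (continuousAt_const (y := b x (i + 1) i)).congr ?_
  filter_upwards [hmem] with y hy
  rw [cylinder_eq_res] at hy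
  have := hb y (i + 1)
  rw [show res y (i + 1) = res x (i + 1) from hy] at this
  exact hagree x (i + 1) _ (hb x _) _ this i i.lt_succ_self

/-- Join two labelled binary trees under a new root. -/
def glueTrees {β : Type*} (f : Bool → List Bool → β) (b : β) : List Bool → β
  | [] => b
  | i :: s => f i s

/-- The trees obtained by gluing two members of `S` whose labels at `s` form the pair `ψ w`,
with `w` recorded at the new root. -/
def gluedPairs (ψ : (ℕ → ℕ) → Cantor × Cantor) (s : List Bool)
    (S : Set (List Bool → Cantor × (ℕ → ℕ))) : Set (List Bool → Cantor × (ℕ → ℕ)) :=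
  {γ | ∃ f : Bool → List Bool → Cantor × (ℕ → ℕ), ∃ w, (∀ i, f i ∈ S) ∧
    ψ w = ((f false s).1, (f true s).1) ∧ ∃ z, γ = glueTrees f (z, w)}

/-- `A` meets only countably many classes of `E`. -/
def CountablyCovered (E : Cantor → Cantor → Prop) (A : Set Cantor) : Prop :=
  ∃ T : Set Cantor, T.Countable ∧ ∀ x ∈ A, ∃ t ∈ T, E t x

theorem CountablyCovered.iUnion {E : Cantor → Cantor → Prop} {ι : Type*} [Countable ι]
    {A : ι → Set Cantor} (h : ∀ i, CountablyCovered E (A i)) : CountablyCovered E (⋃ i, A i) := by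
  choose T hT hA using h
  refine ⟨⋃ i, T i, countable_iUnion hT, fun x hx => ?_⟩
  obtain ⟨i, hi⟩ := mem_iUnion.1 hx
  obtain ⟨t, ht, hE⟩ := hA i x hi
  exact ⟨t, mem_iUnion_of_mem i ht, hE⟩

theorem CountablyCovered.union {E : Cantor → Cantor → Prop} {A B : Set Cantor}
    (hA : CountablyCovered E A) (hB : CountablyCovered E B) : CountablyCovered E (A ∪ B) := by
  rw [union_eq_iUnion]
  exact CountablyCovered.iUnion fun b => by cases b <;> assumption

/-- For every countably covered `N`, some member of `S` has all its labels at level `n` off `N`. -/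
def LargeTrees (E : Cantor → Cantor → Prop) (n : ℕ)
    (S : Set (List Bool → Cantor × (ℕ → ℕ))) : Prop :=
  ∀ N, CountablyCovered E N → ∃ γ ∈ S, ∀ s : List Bool, s.length = n → (γ s).1 ∉ N

theorem LargeTrees.nonempty {E : Cantor → Cantor → Prop} {n : ℕ}
    {S : Set (List Bool → Cantor × (ℕ → ℕ))} (h : LargeTrees E n S) : S.Nonempty := by
  obtain ⟨γ, hγ, -⟩ := h ∅ ⟨∅, countable_empty, by simp⟩
  exact ⟨γ, hγ⟩

theorem LargeTrees.exists_fiber {E : Cantor → Cantor → Prop} {n : ℕ}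
    {S : Set (List Bool → Cantor × (ℕ → ℕ))} (h : LargeTrees E n S) {ι : Type*} [Countable ι]
    (c : (List Bool → Cantor × (ℕ → ℕ)) → ι) : ∃ i, LargeTrees E n (S ∩ c ⁻¹' {i}) := by
  by_contra! H
  simp only [LargeTrees] at H
  push Not at H
  choose N hN hbad using H
  obtain ⟨γ, hγ, hs⟩ := h _ (CountablyCovered.iUnion hN)
  obtain ⟨s, hsn, hmem⟩ := hbad (c γ) γ ⟨hγ, rfl⟩
  exact hs s hsn (mem_iUnion_of_mem _ hmem)

theorem LargeTrees.gluedPairs {E : Cantor → Cantor → Prop}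
    {ψ : (ℕ → ℕ) → Cantor × Cantor} (hψ : range ψ = {p | ¬ E p.1 p.2}) {n : ℕ}
    {S : Set (List Bool → Cantor × (ℕ → ℕ))} (h : LargeTrees E n S)
    {s : List Bool} (hs : s.length = n) : LargeTrees E (n + 1) (gluedPairs ψ s S) := by
  intro N hN
  by_contra! H
  set A : Set Cantor := {x | ∃ γ ∈ S, (∀ t : List Bool, t.length = n → (γ t).1 ∉ N) ∧ (γ s).1 = x}
    with hA
  have hAE : ∀ x ∈ A, ∀ y ∈ A, E x y := by
    rintro x ⟨γ₀, h₀, h₀N, rfl⟩ y ⟨γ₁, h₁, h₁N, rfl⟩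
    by_contra hE
    obtain ⟨w, hw⟩ : ((γ₀ s).1, (γ₁ s).1) ∈ range ψ := by rw [hψ]; exact hE
    obtain ⟨t, ht, htN⟩ := H (glueTrees (fun i => cond i γ₁ γ₀) ((γ₀ s).1, w))
      ⟨_, w, by rintro (_ | _) <;> simpa, hw, _, rfl⟩
    match t, ht with
    | false :: t, ht => exact h₀N t (by simpa using ht) htN
    | true :: t, ht => exact h₁N t (by simpa using ht) htN
  have hAc : CountablyCovered E A := by
    rcases A.eq_empty_or_nonempty with h0 | ⟨a, ha⟩
    · exact ⟨∅, countable_empty, by simp [h0]⟩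
    · exact ⟨{a}, countable_singleton a, fun x hx => ⟨a, rfl, hAE a ha x hx⟩⟩
  obtain ⟨γ, hγ, hγN⟩ := h (N ∪ A) (hN.union hAc)
  exact hγN s hs (Or.inr ⟨γ, hγ, fun t ht hm => hγN t ht (Or.inl hm), rfl⟩)

theorem exists_seq_largeTrees {E : Cantor → Cantor → Prop}
    {ψ : (ℕ → ℕ) → Cantor × Cantor} (hψ : range ψ = {p | ¬ E p.1 p.2})
    (hE : ¬ CountablyCovered E univ) (d : ℕ → Cantor) :
    ∃ S : ℕ → Set (List Bool → Cantor × (ℕ → ℕ)), (∀ n, LargeTrees E n (S n)) ∧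
      (∀ n, S (n + 1) ⊆ gluedPairs ψ (res (d n) n) (S n)) ∧
      ∀ n, ∀ γ ∈ S n, ∀ γ' ∈ S n, ∀ s : List Bool, s.length ≤ n → ∀ i < n,
        (γ s).1 i = (γ' s).1 i ∧ (γ s).2 i = (γ' s).2 i := by
  have step : ∀ n S, LargeTrees E n S → ∃ S', LargeTrees E (n + 1) S' ∧
      S' ⊆ gluedPairs ψ (res (d n) n) S ∧ ∀ γ ∈ S', ∀ γ' ∈ S', ∀ s : List Bool,
        s.length ≤ n + 1 → ∀ i < n + 1, (γ s).1 i = (γ' s).1 i ∧ (γ s).2 i = (γ' s).2 i := by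
    intro n S hS
    have : Finite {s : List Bool // s.length ≤ n + 1} := List.finite_length_le Bool (n + 1)
    obtain ⟨c, hc⟩ := (hS.gluedPairs hψ (res_length (d n) n)).exists_fiber
      (fun γ (s : {s : List Bool // s.length ≤ n + 1}) =>
        (res (γ s).1 (n + 1), res (γ s).2 (n + 1)))
    refine ⟨_, hc, inter_subset_left, ?_⟩
    rintro γ ⟨-, hγ⟩ γ' ⟨-, hγ'⟩ s hs i hi
    have h := congrFun (hγ.trans hγ'.symm) ⟨s, hs⟩
    simp only [Prod.mk.injEq, res_eq_res] at h
    exact ⟨h.1 hi, h.2 hi⟩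
  choose next hlarge hsub hag using step
  have h0 : LargeTrees E 0 univ := by
    intro N hN
    have : N ≠ univ := by rintro rfl; exact hE hN
    obtain ⟨x, hx⟩ := (ne_univ_iff_exists_notMem N).1 this
    exact ⟨fun _ => (x, 0), mem_univ _, fun _ _ => hx⟩
  let T : ∀ n, {S // LargeTrees E n S} := fun n =>
    Nat.rec ⟨univ, h0⟩ (fun n S => ⟨next n S.1 S.2, hlarge n S.1 S.2⟩) n
  refine ⟨fun n => (T n).1, fun n => (T n).2, fun n => hsub n _ (T n).2, ?_⟩
  rintro (_ | n)
  · intro _ _ _ _ _ _ i hi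
    exact absurd hi (Nat.not_lt_zero i)
  · exact hag n _ (T n).2

theorem res_add (x : Cantor) (k j : ℕ) : res x (k + j) = res (fun i => x (k + i)) j ++ res x k := by
  induction j with
  | zero => simp
  | succ j ih => rw [← add_assoc, res_succ, ih, res_succ]; rfl

/-- The non-Borel part of the `G₀` dichotomy: if `E` has uncountably many classes, there is a
continuous homomorphism from the graph `G₀` determined by `d` to the complement of `E`. -/
theorem exists_continuous_homomorphism {E : Cantor → Cantor → Prop}
    (hE : ¬ CountablyCovered E univ)
    (han : AnalyticSet {p : Cantor × Cantor | ¬ E p.1 p.2}) (d : ℕ → Cantor) :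
    ∃ U : Cantor → Cantor, Continuous U ∧ ∀ k x, x ∈ PiNat.cylinder (d k) k → x k = false →
      ¬ E (U x) (U (Function.update x k true)) := by
  rw [AnalyticSet] at han
  obtain h0 | ⟨ψ, hψc, hψ⟩ := han
  · refine absurd ⟨{default}, countable_singleton _, fun x _ => ⟨default, rfl, ?_⟩⟩ hE
    by_contra h
    exact (h0 ▸ (show (default, x) ∈ {p : Cantor × Cantor | ¬ E p.1 p.2} from h) :
      (default, x) ∈ (∅ : Set (Cantor × Cantor)))
  obtain ⟨S, hlarge, hsub, hag⟩ := exists_seq_largeTrees hψ hE d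
  choose γ hγ using fun n => (hlarge n).nonempty
  have hcons : ∀ n, ∀ δ ∈ S (n + 1), ∀ i, ∃ δ' ∈ S n, ∀ s, δ (i :: s) = δ' s := by
    intro n δ hδ i
    obtain ⟨f, w, hf, -, z, rfl⟩ := hsub n hδ
    exact ⟨f i, hf i, fun s => rfl⟩
  obtain ⟨U, hUc, hU⟩ := exists_continuous_of_scheme
    (fun n s => (fun δ : List Bool → Cantor × (ℕ → ℕ) => (δ s).1) '' S n)
    (fun x n => (hlarge n).nonempty.image _)
    (by
      rintro n i s _ ⟨δ, hδ, rfl⟩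
      obtain ⟨δ', h', hs⟩ := hcons n δ hδ i
      exact ⟨δ', h', by simp [hs]⟩)
    (by
      rintro x n _ ⟨δ, hδ, rfl⟩ _ ⟨δ', hδ', rfl⟩ i hi
      exact (hag n δ hδ δ' hδ' _ (res_length x n).le i hi).1)
  refine ⟨U, hUc, fun k x hx hxk => ?_⟩
  obtain ⟨V, -, hV⟩ := exists_continuous_of_scheme
    (fun j t => (fun δ : List Bool → Cantor × (ℕ → ℕ) => (δ t).2) '' S (k + 1 + j))
    (fun x n => (hlarge _).nonempty.image _)
    (by
      rintro j i s _ ⟨δ, hδ, rfl⟩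
      obtain ⟨δ', h', hs⟩ := hcons (k + 1 + j) δ hδ i
      exact ⟨δ', h', by simp [hs]⟩)
    (by
      rintro x n _ ⟨δ, hδ, rfl⟩ _ ⟨δ', hδ', rfl⟩ i hi
      exact (hag _ δ hδ δ' hδ' _ (by rw [res_length]; omega) i (by omega)).2)
  have hedge : ∀ (y : Cantor) j, ∀ δ ∈ S (k + 1 + j), ψ (δ (res y j)).2 =
      ((δ (res y j ++ false :: res (d k) k)).1, (δ (res y j ++ true :: res (d k) k)).1) := by
    intro y j
    induction j with
    | zero =>
      intro δ hδ
      obtain ⟨f, w, hf, hw, z, rfl⟩ := hsub k hδ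
      exact hw
    | succ j ih =>
      intro δ hδ
      obtain ⟨δ', h', hs⟩ := hcons (k + 1 + j) δ hδ (y j)
      simpa [hs] using ih δ' h'
  set x' := Function.update x k true with hx'
  set y : Cantor := fun i => x (k + 1 + i) with hy
  have hres : ∀ j, res x (k + 1 + j) = res y j ++ false :: res (d k) k := by
    intro j
    rw [res_add, res_succ, hxk]
    rw [cylinder_eq_res] at hx
    rw [show res x k = res (d k) k from hx]
  have hres' : ∀ j, res x' (k + 1 + j) = res y j ++ true :: res (d k) k := by
    intro j
    rw [res_add, res_succ]
    have h1 : (fun i => x' (k + 1 + i)) = y := by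
      funext i
      simp [hx', hy, Function.update_of_ne (show k + 1 + i ≠ k by omega)]
    have h2 : res x' k = res (d k) k := by
      rw [cylinder_eq_res] at hx
      rw [← show res x k = res (d k) k from hx, res_eq_res]
      intro m hm
      simp [hx', Function.update_of_ne hm.ne]
    rw [h1, h2]
    simp [hx']
  have htU : ∀ z, Tendsto (fun j => (γ (k + 1 + j) (res z (k + 1 + j))).1) atTop (𝓝 (U z)) :=
    fun z => tendsto_of_eventually_agree fun j i hi =>
      hU z (k + 1 + j) _ ⟨_, hγ _, rfl⟩ i (by omega)
  have htV : Tendsto (fun j => (γ (k + 1 + j) (res y j)).2) atTop (𝓝 (V y)) :=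
    tendsto_of_eventually_agree fun j i hi => hV y j _ ⟨_, hγ _, rfl⟩ i hi
  have hlim := (htU x).prodMk_nhds (htU x')
  have heq : ψ (V y) = (U x, U x') := by
    refine tendsto_nhds_unique ((hψc.tendsto _).comp htV) (hlim.congr fun j => ?_)
    simp only [Function.comp_apply, hedge y j _ (hγ _), hres, hres']
  have hmem : ψ (V y) ∈ {p : Cantor × Cantor | ¬ E p.1 p.2} := hψ ▸ mem_range_self _
  rw [heq] at hmem
  exact hmem

theorem isMeagre_of_forall_exists_isMeagre_inter {X : Type*} [TopologicalSpace X]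
    [SecondCountableTopology X] {A : Set X}
    (h : ∀ x ∈ A, ∃ O ∈ 𝓝 x, IsMeagre (A ∩ O)) : IsMeagre A := by
  have hb := TopologicalSpace.isBasis_countableBasis X
  have hsub : A ⊆ ⋃ O : {O // O ∈ TopologicalSpace.countableBasis X ∧ IsMeagre (A ∩ O)},
      A ∩ O.1 := by
    intro x hx
    obtain ⟨O, hO, hm⟩ := h x hx
    obtain ⟨O', hO', hxO', hsub⟩ := hb.mem_nhds_iff.1 hO
    exact mem_iUnion.2 ⟨⟨O', hO', hm.mono (inter_subset_inter_right A hsub)⟩, hx, hxO'⟩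
  have : Countable {O // O ∈ TopologicalSpace.countableBasis X ∧ IsMeagre (A ∩ O)} :=
    ((TopologicalSpace.countable_countableBasis X).mono fun O hO => hO.1).to_subtype
  exact (isMeagre_iUnion fun O => O.2.2).mono hsub

/-- Points at which `A` is everywhere non-meagre. -/
def nonmeagreKernel {X : Type*} [TopologicalSpace X] (A : Set X) : Set X :=
  {x | ∀ O ∈ 𝓝 x, ¬ IsMeagre (A ∩ O)}

theorem isClosed_nonmeagreKernel {X : Type*} [TopologicalSpace X] (A : Set X) :
    IsClosed (nonmeagreKernel A) := by
  rw [← isOpen_compl_iff, isOpen_iff_mem_nhds]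
  intro x hx
  simp only [nonmeagreKernel, mem_compl_iff, mem_ofPred_eq, not_forall, not_not] at hx
  obtain ⟨O, hO, hm⟩ := hx
  filter_upwards [eventually_mem_nhds_iff.2 hO] with y hy hk
  exact hk O hy hm

theorem isMeagre_diff_nonmeagreKernel {X : Type*} [TopologicalSpace X]
    [SecondCountableTopology X] (A : Set X) : IsMeagre (A \ nonmeagreKernel A) := by
  refine isMeagre_of_forall_exists_isMeagre_inter fun x hx => ?_
  have := hx.2
  simp only [nonmeagreKernel, mem_ofPred_eq, not_forall, not_not] at this
  obtain ⟨O, hO, hm⟩ := this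
  exact ⟨O, hO, hm.mono (inter_subset_inter_left O sdiff_subset)⟩

theorem isMeagre_nonmeagreKernel_diff_iUnion {X : Type*} [TopologicalSpace X]
    [SecondCountableTopology X] [BaireSpace X] {A : Set X} {ι : Type*} [Countable ι]
    {B : ι → Set X} (h : A ⊆ ⋃ i, B i) :
    IsMeagre (nonmeagreKernel A \ ⋃ i, nonmeagreKernel (B i)) := by
  set M := nonmeagreKernel A \ ⋃ i, nonmeagreKernel (B i) with hM
  borelize X
  have hMm : MeasurableSet M := (isClosed_nonmeagreKernel A).measurableSet.diff
    (.iUnion fun i => (isClosed_nonmeagreKernel (B i)).measurableSet)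
  obtain ⟨O, hO, hMO⟩ := hMm.residualEq_isOpen
  have hdiff : IsMeagre (O \ M) := by
    filter_upwards [hMO] with x hx hx'
    exact hx'.2 (hx.symm.mp hx'.1)
  have hdiff' : IsMeagre (M \ O) := by
    filter_upwards [hMO] with x hx hx'
    exact hx'.2 (hx.mp hx'.1)
  rcases O.eq_empty_or_nonempty with rfl | hne
  · simpa using hdiff'
  exfalso
  have hOM : (O ∩ M).Nonempty := by
    by_contra hemp
    have : IsMeagre O := by
      refine hdiff.mono fun x hx => (⟨hx, fun hxM => hemp ⟨x, hx, hxM⟩⟩ : x ∈ O \ M)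
    obtain ⟨x, hxO, hx⟩ := (dense_of_mem_residual this).inter_open_nonempty O hO hne
    exact hx hxO
  obtain ⟨x, hxO, hxM⟩ := hOM
  refine hxM.1 O (hO.mem_nhds hxO) ?_
  have hsmall : IsMeagre (⋃ i, B i \ nonmeagreKernel (B i)) :=
    isMeagre_iUnion fun i => isMeagre_diff_nonmeagreKernel (B i)
  refine (hdiff.union hsmall).mono ?_
  rintro y ⟨hyA, hyO⟩
  by_cases hyM : y ∈ M
  · obtain ⟨i, hi⟩ := mem_iUnion.1 (h hyA)
    exact Or.inr (mem_iUnion.2 ⟨i, hi, fun hk => hyM.2 (mem_iUnion.2 ⟨i, hk⟩)⟩)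
  · exact Or.inl ⟨hyO, hyM⟩

/-- Analytic sets have the Baire property. -/
theorem AnalyticSet.baireMeasurableSet {X : Type*} [TopologicalSpace X]
    [SecondCountableTopology X] [BaireSpace X] [T2Space X] {A : Set X} (hA : AnalyticSet A) :
    BaireMeasurableSet A := by
  rw [AnalyticSet] at hA
  obtain rfl | ⟨f, hf, rfl⟩ := hA
  · exact isOpen_empty.baireMeasurableSet
  set A : List ℕ → Set X := fun l => f '' {z | res z l.length = l} with hAdef
  have hA0 : A [] = range f := by simp [hAdef]
  have hAsucc : ∀ l, A l ⊆ ⋃ n, A (n :: l) := by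
    rintro l _ ⟨z, hz, rfl⟩
    refine mem_iUnion.2 ⟨z l.length, z, ?_, rfl⟩
    simpa using hz
  set M : Set X := ⋃ l, nonmeagreKernel (A l) \ ⋃ n, nonmeagreKernel (A (n :: l)) with hM
  have hMm : IsMeagre M :=
    isMeagre_iUnion fun l => isMeagre_nonmeagreKernel_diff_iUnion (hAsucc l)
  have hsub : nonmeagreKernel (A []) \ range f ⊆ M := by
    rintro x ⟨hx, hxf⟩
    by_contra hxM
    have hstep : ∀ l : {l // x ∈ nonmeagreKernel (A l)}, ∃ n,
        x ∈ nonmeagreKernel (A (n :: l.1)) := by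
      rintro ⟨l, hl⟩
      by_contra hn
      exact hxM (mem_iUnion.2 ⟨l, hl, fun h => hn (mem_iUnion.1 h)⟩)
    choose a ha using hstep
    let l : ℕ → {l // x ∈ nonmeagreKernel (A l)} := fun n =>
      Nat.rec ⟨[], hx⟩ (fun _ l => ⟨a l :: l.1, ha l⟩) n
    set z : ℕ → ℕ := fun n => a (l n) with hz
    have hl : ∀ n, (l n).1 = res z n := by
      intro n
      induction n with
      | zero => rfl
      | succ n ih => rw [res_succ, ← ih]
    have hne : x ≠ f z := fun h => hxf ⟨z, h.symm⟩
    obtain ⟨O, O', hO, hO', hxO, hzO', hdisj⟩ := t2_separation hne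
    obtain ⟨_, ⟨y, n, rfl⟩, hyz, hyO⟩ := (isTopologicalBasis_cylinders (fun _ => ℕ)).mem_nhds_iff.1
      ((hO'.preimage hf).mem_nhds hzO')
    have hn := (l n).2 O (hO.mem_nhds hxO)
    apply hn
    convert IsMeagre.empty
    rw [eq_empty_iff_forall_notMem]
    rintro _ ⟨⟨w, hw, rfl⟩, hwO⟩
    rw [mem_ofPred_eq, hl, res_length] at hw
    refine disjoint_left.1 hdisj hwO (hyO ?_)
    rw [mem_cylinder_iff_eq.1 hyz |>.symm, cylinder_eq_res]
    exact hw
  have heq : range f =ᵇ nonmeagreKernel (A []) := by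
    have h1 := isMeagre_diff_nonmeagreKernel (A [])
    have h2 := hMm.mono hsub
    rw [hA0] at h1 h2 ⊢
    filter_upwards [h1, h2] with x hx1 hx2
    simp only [mem_compl_iff, Set.mem_sdiff, not_and, not_not] at hx1 hx2
    exact propext ⟨hx1, hx2⟩
  borelize X
  exact (isClosed_nonmeagreKernel _).measurableSet.baireMeasurableSet.congr heq.symm

/-- The easy direction of the Kuratowski–Ulam theorem. -/
theorem residual_isMeagre_preimage_mk {X Y : Type*} [TopologicalSpace X] [TopologicalSpace Y]
    [SecondCountableTopology Y] {A : Set (X × Y)} (hA : IsMeagre A) :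
    ∀ᶠ x in residual X, IsMeagre (Prod.mk x ⁻¹' A) := by
  obtain ⟨T, hTo, hTd, hTc, hTA⟩ := mem_residual_iff.1 hA
  have key : ∀ W ∈ T, ∀ᶠ x in residual X, Dense (Prod.mk x ⁻¹' W) := by
    intro W hW
    have hb := TopologicalSpace.isBasis_countableBasis Y
    have hV : ∀ V ∈ TopologicalSpace.countableBasis Y,
        ∀ᶠ x in residual X, (V ∩ Prod.mk x ⁻¹' W).Nonempty := by
      intro V hV
      have hset : {x | (V ∩ Prod.mk x ⁻¹' W).Nonempty} = Prod.fst '' (W ∩ univ ×ˢ V) := by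
        ext x
        constructor
        · rintro ⟨y, hy, hW⟩
          exact ⟨(x, y), ⟨hW, trivial, hy⟩, rfl⟩
        · rintro ⟨⟨x, y⟩, ⟨hW, -, hy⟩, rfl⟩
          exact ⟨y, hy, hW⟩
      have hVo := hb.isOpen hV
      refine residual_of_dense_open (s := {x | (V ∩ Prod.mk x ⁻¹' W).Nonempty}) ?_ ?_
      · rw [hset]
        exact isOpenMap_fst _ ((hTo W hW).inter (isOpen_univ.prod hVo))
      · rw [dense_iff_inter_open]
        rintro U hU ⟨x, hx⟩
        obtain ⟨y, hy⟩ := TopologicalSpace.nonempty_of_mem_countableBasis hV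
        obtain ⟨⟨x', y'⟩, ⟨hx', hy'⟩, hW'⟩ := (hTd W hW).inter_open_nonempty (U ×ˢ V)
          (hU.prod hVo) ⟨(x, y), hx, hy⟩
        exact ⟨x', hx', y', hy', hW'⟩
    have := (eventually_countable_ball (TopologicalSpace.countable_countableBasis Y)).2 hV
    filter_upwards [this] with x hx
    rw [hb.dense_iff]
    intro V hV _
    exact hx V hV
  filter_upwards [(eventually_countable_ball hTc).2 key] with x hx
  refine mem_residual_iff.2 ⟨(Prod.mk x ⁻¹' ·) '' T, ?_, ?_, hTc.image _, ?_⟩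
  · rintro _ ⟨W, hW, rfl⟩
    exact (hTo W hW).preimage (by fun_prop)
  · rintro _ ⟨W, hW, rfl⟩
    exact hx W hW
  · intro y hy
    refine hTA (mem_sInter.2 fun W hW => hy _ ⟨W, hW, rfl⟩)

theorem exists_refinement_of_dense {X ι : Type*} [TopologicalSpace X] {W : Set (X × X)}
    (hWo : IsOpen W) (hWd : Dense W) (F : Finset (ι × ι)) (hF : ∀ p ∈ F, p.1 ≠ p.2)
    (C : ι → Set X) (hC : ∀ i, IsOpen (C i) ∧ (C i).Nonempty) :
    ∃ C' : ι → Set X, (∀ i, IsOpen (C' i) ∧ (C' i).Nonempty) ∧ (∀ i, C' i ⊆ C i) ∧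
      ∀ p ∈ F, C' p.1 ×ˢ C' p.2 ⊆ W := by
  classical
  induction F using Finset.induction_on with
  | empty => exact ⟨C, hC, fun i => subset_rfl, by simp⟩
  | insert p F hp ih =>
    obtain ⟨C₁, h₁, hsub, hW⟩ := ih fun q hq => hF q (Finset.mem_insert_of_mem hq)
    obtain ⟨i, j⟩ := p
    have hij : i ≠ j := hF _ (Finset.mem_insert_self _ _)
    obtain ⟨x, hx⟩ := (h₁ i).2
    obtain ⟨y, hy⟩ := (h₁ j).2
    obtain ⟨⟨x', y'⟩, ⟨hx', hy'⟩, hW'⟩ := hWd.inter_open_nonempty (C₁ i ×ˢ C₁ j)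
      ((h₁ i).1.prod (h₁ j).1) ⟨(x, y), hx, hy⟩
    obtain ⟨A, B, hA, hB, hxA, hyB, hAB⟩ := isOpen_prod_iff.1 hWo x' y' hW'
    set C₂ : ι → Set X :=
      fun k => C₁ k ∩ ((if k = i then A else univ) ∩ (if k = j then B else univ)) with hC₂
    have h₂₁ : ∀ k, C₂ k ⊆ C₁ k := fun k => inter_subset_left
    refine ⟨C₂, fun k => ⟨?_, ?_⟩, fun k => (h₂₁ k).trans (hsub k), ?_⟩
    · refine (h₁ k).1.inter (IsOpen.inter ?_ ?_) <;> split_ifs <;> simp [*]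
    · by_cases hki : k = i
      · subst hki
        exact ⟨x', hx', by simp [hxA, hij]⟩
      · by_cases hkj : k = j
        · subst hkj
          exact ⟨y', hy', by simp [hyB, hki]⟩
        · simpa [hC₂, hki, hkj] using (h₁ k).2
    · intro q hq
      rcases Finset.mem_insert.1 hq with rfl | hq
      · refine (Set.prod_mono ?_ ?_).trans hAB
        · intro z hz
          simpa using hz.2.1
        · intro z hz
          simpa using hz.2.2
      · exact (Set.prod_mono (h₂₁ _) (h₂₁ _)).trans (hW q hq)

theorem exists_cylinder_subset {O : Set Cantor} (hO : IsOpen O) (hne : O.Nonempty) (n : ℕ) :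
    ∃ C ⊆ O, IsOpen C ∧ C.Nonempty ∧ IsClosed C ∧ ∀ b ∈ C, ∀ c ∈ C, ∀ i < n, b i = c i := by
  obtain ⟨x, hx⟩ := hne
  obtain ⟨_, ⟨y, m, rfl⟩, hxy, hsub⟩ :=
    (isTopologicalBasis_cylinders (fun _ => Bool)).mem_nhds_iff.1 (hO.mem_nhds hx)
  rw [mem_cylinder_iff_eq.1 hxy |>.symm] at hsub
  refine ⟨PiNat.cylinder x (max m n), (cylinder_anti x (le_max_left m n)).trans hsub,
    isOpen_cylinder _ _ _, ⟨x, self_mem_cylinder _ _⟩, ?_, ?_⟩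
  · rw [cylinder_eq_pi]
    exact isClosed_set_pi fun i _ => isClosed_singleton
  · intro b hb c hc i hi
    rw [hb i (by omega), hc i (by omega)]

/-- Mycielski's theorem for binary relations on Cantor space. -/
theorem exists_continuous_of_mem_residual {W : Set (Cantor × Cantor)} (hW : W ∈ residual _) :
    ∃ g : Cantor → Cantor, Continuous g ∧ ∀ x y, x ≠ y → (g x, g y) ∈ W := by
  obtain ⟨G, hGW, hG, hGd⟩ := mem_residual.1 hW
  obtain ⟨f, hfo, rfl⟩ := isGδ_iff_eq_iInter_nat.1 hG
  set D : ℕ → Set (Cantor × Cantor) := fun n => ⋂ m ∈ Finset.range n, f m with hD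
  have hDo : ∀ n, IsOpen (D n) := fun n => isOpen_biInter_finset fun m _ => hfo m
  have hDd : ∀ n, Dense (D n) := fun n => hGd.mono fun p hp =>
    mem_iInter₂.2 fun m _ => mem_iInter.1 hp m
  have step : ∀ (n : ℕ) (C : List Bool → Set Cantor), (∀ s, IsOpen (C s) ∧ (C s).Nonempty) →
      ∃ C' : List Bool → Set Cantor, (∀ s, IsOpen (C' s) ∧ (C' s).Nonempty) ∧
        (∀ i s, C' (i :: s) ⊆ C s) ∧
        (∀ s t, s.length = n + 1 → t.length = n + 1 → s ≠ t → C' s ×ˢ C' t ⊆ D (n + 1)) ∧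
        ∀ s, IsClosed (C' s) ∧ ∀ b ∈ C' s, ∀ c ∈ C' s, ∀ i < n + 1, b i = c i := by
    intro n C hC
    have hfin : {p : List Bool × List Bool |
        p.1.length = n + 1 ∧ p.2.length = n + 1 ∧ p.1 ≠ p.2}.Finite :=
      ((List.finite_length_eq Bool (n + 1)).prod (List.finite_length_eq Bool (n + 1))).subset
        fun p hp => ⟨hp.1, hp.2.1⟩
    obtain ⟨C₁, h₁, hsub₁, hD₁⟩ := exists_refinement_of_dense (hDo (n + 1)) (hDd (n + 1))
      hfin.toFinset (fun p hp => ((hfin.mem_toFinset).1 hp).2.2) (fun s => C s.tail)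
      (fun s => hC _)
    choose C' hC' hopen hne hcl hag using
      fun s => exists_cylinder_subset (h₁ s).1 (h₁ s).2 (n + 1)
    refine ⟨C', fun s => ⟨hopen s, hne s⟩, fun i s => (hC' _).trans (hsub₁ (i :: s)),
      fun s t hs ht hst => (Set.prod_mono (hC' s) (hC' t)).trans
        (hD₁ (s, t) ((hfin.mem_toFinset).2 ⟨hs, ht, hst⟩)), fun s => ⟨hcl s, hag s⟩⟩
  choose next hnext hsub hdisj hcl using step
  let T : ℕ → {C : List Bool → Set Cantor // ∀ s, IsOpen (C s) ∧ (C s).Nonempty} := fun n =>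
    Nat.rec ⟨fun _ => univ, fun _ => ⟨isOpen_univ, univ_nonempty⟩⟩
      (fun n C => ⟨next n C.1 C.2, hnext n C.1 C.2⟩) n
  have hclosed : ∀ n s, IsClosed ((T n).1 s) := by
    rintro (_ | n) s
    · exact isClosed_univ
    · exact (hcl n _ (T n).2 s).1
  have hanti : ∀ n i s, (T (n + 1)).1 (i :: s) ⊆ (T n).1 s := fun n => hsub n _ (T n).2
  obtain ⟨g, hgc, hg⟩ := exists_continuous_of_scheme (fun n s => (T n).1 s)
    (fun x n => ((T n).2 _).2) hanti
    (by
      rintro x (_ | n) b hb c hc i hi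
      · exact absurd hi (Nat.not_lt_zero i)
      · exact (hcl n _ (T n).2 _).2 b hb c hc i hi)
  have hmem : ∀ x n, g x ∈ (T n).1 (res x n) := by
    intro x n
    choose b hb using fun m => ((T m).2 (res x m)).2
    have hlim : Tendsto b atTop (𝓝 (g x)) :=
      tendsto_of_eventually_agree fun m i hi => hg x m _ (hb m) i hi
    refine (hclosed n _).mem_of_tendsto hlim ?_
    filter_upwards [eventually_ge_atTop n] with m hm
    have hmono : (T m).1 (res x m) ⊆ (T n).1 (res x n) := by
      induction m, hm using Nat.le_induction with
      | base => exact subset_rfl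
      | succ m _ ih => exact (hanti m (x m) (res x m)).trans ih
    exact hmono (hb m)
  refine ⟨g, hgc, fun x y hxy => hGW (mem_iInter.2 fun m => ?_)⟩
  set n := max m (firstDiff x y) with hn
  have hres : res x (n + 1) ≠ res y (n + 1) := by
    rw [Ne, res_eq_res]
    exact fun h => apply_firstDiff_ne hxy (h (by omega))
  have : (g x, g y) ∈ D (n + 1) :=
    hdisj n _ (T n).2 (res x (n + 1)) (res y (n + 1)) (res_length _ _) (res_length _ _) hres
      ⟨hmem x (n + 1), hmem y (n + 1)⟩
  exact mem_iInter₂.1 this m (Finset.mem_range.2 (by omega))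

theorem isMeagre_of_forall_update {F : Cantor → Cantor → Prop} (hF : Equivalence F)
    (han : AnalyticSet {p : Cantor × Cantor | ¬ F p.1 p.2}) {d : ℕ → Cantor}
    (hd : ∀ x k, ∃ n ≥ k, d n ∈ PiNat.cylinder x k)
    (hedge : ∀ n x, x ∈ PiNat.cylinder (d n) n → x n = false → ¬ F x (Function.update x n true)) :
    IsMeagre {p : Cantor × Cantor | F p.1 p.2} := by
  obtain ⟨O, hO, hFO⟩ := (AnalyticSet.baireMeasurableSet han).compl.residualEq_isOpen
  have hdiff : IsMeagre {p : Cantor × Cantor | p ∈ O ∧ ¬ F p.1 p.2} := by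
    filter_upwards [hFO] with p hp hp'
    exact (hp.symm.mp hp'.1) hp'.2
  rcases O.eq_empty_or_nonempty with rfl | ⟨⟨x₀, y₀⟩, hxy⟩
  · filter_upwards [hFO] with p hp hp'
    exact hp.mp fun h => h hp'
  exfalso
  obtain ⟨A, B, hA, hB, hxA, hyB, hAB⟩ := isOpen_prod_iff.1 hO x₀ y₀ hxy
  obtain ⟨x, hx, hxm⟩ := (dense_of_mem_residual
    (residual_isMeagre_preimage_mk hdiff)).inter_open_nonempty A hA ⟨x₀, hxA⟩
  set Q : Set Cantor := Prod.mk x ⁻¹' {p : Cantor × Cantor | p ∈ O ∧ ¬ F p.1 p.2} with hQ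
  obtain ⟨_, ⟨y, k, rfl⟩, hyk, hsub⟩ :=
    (isTopologicalBasis_cylinders (fun _ => Bool)).mem_nhds_iff.1 (hB.mem_nhds hyB)
  obtain ⟨n, hnk, hn⟩ := hd y k
  have hsubB : PiNat.cylinder (d n) n ⊆ B := by
    refine ((cylinder_anti (d n) hnk).trans ?_).trans hsub
    rw [mem_cylinder_iff_eq.1 hn]
  have hinv : Function.Involutive fun z : Cantor => Function.update z n (!z n) := by
    intro z
    simp
  have hcont : Continuous fun z : Cantor => Function.update z n (!z n) := by
    fun_prop
  let φ : Cantor ≃ₜ Cantor := ⟨hinv.toPerm _, hcont, hcont⟩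
  have hbad := hxm.union (hxm.preimage_of_isOpenMap φ.continuous φ.isOpenMap)
  have hn₀ : IsOpen {z : Cantor | z n = false} :=
    (continuous_apply (A := fun _ : ℕ => Bool) n).isOpen_preimage {false} (isOpen_discrete _)
  obtain ⟨z, ⟨hzd, hzn⟩, hz⟩ := (dense_of_mem_residual hbad).inter_open_nonempty
    (PiNat.cylinder (d n) n ∩ {z | z n = false})
    ((isOpen_cylinder _ _ _).inter hn₀)
    ⟨Function.update (d n) n false, update_mem_cylinder _ _ _, by simp⟩
  have hφ : φ z = Function.update z n true := by
    change Function.update z n (!z n) = _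
    rw [show z n = false from hzn]
    rfl
  have hφd : φ z ∈ PiNat.cylinder (d n) n := by
    rw [hφ, ← mem_cylinder_iff_eq.1 hzd]
    exact update_mem_cylinder _ _ _
  have h₁ : F x z := by
    by_contra h
    exact hz (Or.inl ⟨hAB ⟨hx, hsubB hzd⟩, h⟩)
  have h₂ : F x (φ z) := by
    by_contra h
    exact hz (Or.inr ⟨hAB ⟨hx, hsubB hφd⟩, h⟩)
  exact hedge n z hzd hzn (hφ ▸ hF.trans (hF.symm h₁) h₂)

theorem exists_frequently_dense_seq :
    ∃ d : ℕ → Cantor, ∀ x k, ∃ n ≥ k, d n ∈ PiNat.cylinder x k := by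
  refine ⟨fun n => TopologicalSpace.denseSeq Cantor n.unpair.1, fun x k => ?_⟩
  obtain ⟨_, hz, i, rfl⟩ := (TopologicalSpace.denseRange_denseSeq Cantor).inter_open_nonempty _
    (isOpen_cylinder _ x k) ⟨x, self_mem_cylinder _ _⟩
  exact ⟨Nat.pair i k, Nat.right_le_pair i k, by simpa using hz⟩

theorem polishSpace_cantor_prod : PolishSpace (Cantor × Cantor) := {}

/-- Silver's dichotomy for equivalence relations on the whole Cantor space. -/
theorem exists_continuous_of_not_countablyCovered {E : Cantor → Cantor → Prop}
    (hE : Equivalence E) (han : AnalyticSet {p : Cantor × Cantor | ¬ E p.1 p.2})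
    (hunc : ¬ CountablyCovered E univ) :
    ∃ h : Cantor → Cantor, Continuous h ∧ ∀ x y, x ≠ y → ¬ E (h x) (h y) := by
  have := polishSpace_cantor_prod
  obtain ⟨d, hd⟩ := exists_frequently_dense_seq
  obtain ⟨U, hU, hedge⟩ := exists_continuous_homomorphism hunc han d
  have hU2 : Continuous (Prod.map U U) := hU.prodMap hU
  have han' : AnalyticSet {p : Cantor × Cantor | ¬ E (U p.1) (U p.2)} := han.preimage hU2
  obtain ⟨g, hg, hgE⟩ := exists_continuous_of_mem_residual
    (isMeagre_of_forall_update (F := fun x y => E (U x) (U y))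
      ⟨fun x => hE.refl _, hE.symm, hE.trans⟩ han' hd hedge)
  exact ⟨U ∘ g, hU.comp hg, hgE⟩

theorem perfect_range_of_continuous_injective {h : Cantor → Cantor} (hc : Continuous h)
    (hi : Function.Injective h) : Perfect (range h) := by
  refine ⟨(isCompact_range hc).isClosed, preperfect_iff_nhds.2 ?_⟩
  rintro _ ⟨x, rfl⟩ O hO
  obtain ⟨_, ⟨y, n, rfl⟩, hxy, hsub⟩ :=
    (isTopologicalBasis_cylinders (fun _ => Bool)).mem_nhds_iff.1 (hc.continuousAt.preimage_mem_nhds hO)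
  rw [← mem_cylinder_iff_eq.1 hxy] at hsub
  refine ⟨h (Function.update x n (!x n)), ⟨hsub (update_mem_cylinder _ _ _), mem_range_self _⟩,
    fun heq => ?_⟩
  simpa using congrFun (hi heq) n

/-- Silver's Dichotomy: a coanalytic equivalence relation on a Borel subset of Cantor
space either has at most countably many classes, or admits a perfect partial transversal. -/
theorem silver_dichotomy (X : Set Cantor) (hX : MeasurableSet X)
    (E : Cantor → Cantor → Prop)
    (hrefl : ∀ x ∈ X, E x x)
    (hsymm : ∀ x ∈ X, ∀ y ∈ X, E x y → E y x)
    (htrans : ∀ x ∈ X, ∀ y ∈ X, ∀ z ∈ X, E x y → E y z → E x z)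
    (hco : IsCoanalytic {p : Cantor × Cantor | p.1 ∈ X ∧ p.2 ∈ X ∧ E p.1 p.2}) :
    {C : Set Cantor | ∃ x ∈ X, C = {y ∈ X | E x y}}.Countable ∨
      ∃ P, P ⊆ X ∧ PerfectSet P ∧ ∀ x ∈ P, ∀ y ∈ P, x ≠ y → ¬ E x y := by
  set E' : Cantor → Cantor → Prop := fun x y => (x ∈ X ∧ y ∈ X ∧ E x y) ∨ (x ∉ X ∧ y ∉ X)
    with hE'
  have hequiv : Equivalence E' := by
    refine ⟨fun x => ?_, ?_, ?_⟩
    · by_cases hx : x ∈ X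
      · exact Or.inl ⟨hx, hx, hrefl x hx⟩
      · exact Or.inr ⟨hx, hx⟩
    · rintro x y (⟨hx, hy, h⟩ | ⟨hx, hy⟩)
      · exact Or.inl ⟨hy, hx, hsymm x hx y hy h⟩
      · exact Or.inr ⟨hy, hx⟩
    · rintro x y z (⟨hx, hy, h⟩ | ⟨hx, hy⟩) (⟨hy', hz, h'⟩ | ⟨hy', hz⟩)
      · exact Or.inl ⟨hx, hz, htrans x hx y hy z hz h h'⟩
      · exact absurd hy hy'
      · exact absurd hy' hy
      · exact Or.inr ⟨hx, hz⟩
  have han : AnalyticSet {p : Cantor × Cantor | ¬ E' p.1 p.2} := by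
    have := polishSpace_cantor_prod
    have hm : AnalyticSet (Xᶜ ×ˢ Xᶜ : Set (Cantor × Cantor))ᶜ :=
      (hX.compl.prod hX.compl).compl.analyticSet
    convert AnalyticSet.iInter (s := fun b : Bool => cond b
      ({p : Cantor × Cantor | p.1 ∈ X ∧ p.2 ∈ X ∧ E p.1 p.2})ᶜ (Xᶜ ×ˢ Xᶜ)ᶜ)
      (by rintro (_ | _) <;> assumption) using 1
    ext p
    simp only [hE', mem_iInter, Bool.forall_bool, cond_true, cond_false]
    change ¬ (_ ∨ _) ↔ ¬ (_ ∧ _) ∧ ¬ (_ ∧ _ ∧ _)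
    simp only [mem_compl_iff]
    tauto
  by_cases hunc : CountablyCovered E' univ
  · left
    obtain ⟨T, hT, hcov⟩ := hunc
    refine (hT.image fun t => {y ∈ X | E t y}).mono ?_
    rintro _ ⟨x, hx, rfl⟩
    obtain ⟨t, ht, (⟨htX, -, htx⟩ | ⟨-, h⟩)⟩ := hcov x trivial
    · refine ⟨t, ht, Set.ext fun y => ⟨fun hy => ⟨hy.1, ?_⟩, fun hy => ⟨hy.1, ?_⟩⟩⟩
      · exact htrans x hx t htX y hy.1 (hsymm t htX x hx htx) hy.2
      · exact htrans t htX x hx y hy.1 htx hy.2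
    · exact absurd hx h
  · right
    obtain ⟨h, hc, hne⟩ := exists_continuous_of_not_countablyCovered hequiv han hunc
    have hinj : Function.Injective h := by
      intro x y hxy
      by_contra hn
      exact hne x y hn (hxy ▸ hequiv.refl _)
    have hpair : ∀ x ∈ range h, ∀ y ∈ range h, x ≠ y → ¬ E' x y := by
      rintro _ ⟨x, rfl⟩ _ ⟨y, rfl⟩ hxy
      exact hne x y fun he => hxy (he ▸ rfl)
    obtain ⟨P₀, P₁, ⟨h₀, hn₀, hs₀⟩, ⟨h₁, hn₁, hs₁⟩, hdisj⟩ :=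
      (perfect_range_of_continuous_injective hc hinj).splitting (range_nonempty h)
    have hfinal : ∀ P, Perfect P → P.Nonempty → P ⊆ range h → P ⊆ X →
        ∃ P, P ⊆ X ∧ PerfectSet P ∧ ∀ x ∈ P, ∀ y ∈ P, x ≠ y → ¬ E x y :=
      fun P hP hPn hPs hPX => ⟨P, hPX, ⟨hP, hPn⟩, fun x hx y hy hxy hxE =>
        hpair x (hPs hx) y (hPs hy) hxy (Or.inl ⟨hPX hx, hPX hy, hxE⟩)⟩
    by_cases hP₀ : P₀ ⊆ X
    · exact hfinal P₀ h₀ hn₀ hs₀ hP₀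
    · obtain ⟨a, ha, haX⟩ := not_subset.1 hP₀
      refine hfinal P₁ h₁ hn₁ hs₁ fun b hb => ?_
      by_contra hbX
      exact hpair a (hs₀ ha) b (hs₁ hb) (fun hab => disjoint_left.1 hdisj ha (hab ▸ hb))
        (Or.inr ⟨haX, hbX⟩)
end

section
/- If X ⊆ 2^ω is a perfect set and f : X → 2^ω is a Borel map, then there is a perfect set Y ⊆ X such that the restriction f↾Y is either injective or constant. -/
open MeasureTheory

open Set Filter Topology

/-- A refinement step for a Cantor scheme along which a continuous map separates branches. -/
theorem exists_bool_refinement {α β : Type*} [MetricSpace α] [TopologicalSpace β] [T2Space β]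
    {f : α → β} (hf : Continuous f) {A : Set α} (hA : Preperfect A) (hfA : InjOn f A)
    {U : Set α} (hU : IsOpen U) (hUA : (U ∩ A).Nonempty) {ε : ENNReal} (hε : 0 < ε) :
    ∃ V : Bool → Set α, (∀ b, IsOpen (V b) ∧ (V b ∩ A).Nonempty ∧ closure (V b) ⊆ U ∧
      Metric.ediam (V b) ≤ ε) ∧ Disjoint (f '' V false) (f '' V true) := by
  have shrink : ∀ W : Set α, IsOpen W → ∀ x ∈ W ∩ A, ∃ V ⊆ W, IsOpen V ∧ (V ∩ A).Nonempty ∧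
      closure V ⊆ W ∧ Metric.ediam V ≤ ε := by
    rintro W hW x ⟨hxW, hxA⟩
    obtain ⟨T, hT, hTc, hTW⟩ := exists_mem_nhds_isClosed_subset (hW.mem_nhds hxW)
    have hsub : interior T ∩ Metric.eball x (ε / 2) ⊆ T :=
      inter_subset_left.trans interior_subset
    refine ⟨interior T ∩ Metric.eball x (ε / 2), hsub.trans hTW,
      isOpen_interior.inter Metric.isOpen_eball,
      ⟨x, ⟨mem_interior_iff_mem_nhds.2 hT, Metric.mem_eball_self (ENNReal.half_pos hε.ne')⟩, hxA⟩,
      (closure_minimal hsub hTc).trans hTW, ?_⟩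
    calc Metric.ediam (interior T ∩ Metric.eball x (ε / 2))
        ≤ Metric.ediam (Metric.eball x (ε / 2)) := Metric.ediam_mono inter_subset_right
      _ ≤ 2 * (ε / 2) := Metric.ediam_eball_le
      _ = ε := ENNReal.mul_div_cancel (by simp) (by simp)
  obtain ⟨x, hxU, hxA⟩ := hUA
  obtain ⟨y, ⟨hyU, hyA⟩, hyx⟩ := preperfect_iff_nhds.1 hA x hxA U (hU.mem_nhds hxU)
  obtain ⟨O₀, O₁, hO₀, hO₁, hx, hy, hd⟩ := t2_separation (fun h => hyx (hfA hxA hyA h).symm)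
  obtain ⟨V₀, hV₀, ho₀, hn₀, hc₀, hd₀⟩ :=
    shrink (U ∩ f ⁻¹' O₀) (hU.inter (hO₀.preimage hf)) x ⟨⟨hxU, hx⟩, hxA⟩
  obtain ⟨V₁, hV₁, ho₁, hn₁, hc₁, hd₁⟩ :=
    shrink (U ∩ f ⁻¹' O₁) (hU.inter (hO₁.preimage hf)) y ⟨⟨hyU, hy⟩, hyA⟩
  refine ⟨fun b => cond b V₁ V₀, ?_, ?_⟩
  · rintro (_ | _)
    · exact ⟨ho₀, hn₀, hc₀.trans inter_subset_left, hd₀⟩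
    · exact ⟨ho₁, hn₁, hc₁.trans inter_subset_left, hd₁⟩
  · exact hd.mono (image_subset_iff.2 (hV₀.trans inter_subset_right))
      (image_subset_iff.2 (hV₁.trans inter_subset_right))

theorem exists_continuous_comp_injective_of_preperfect {α β : Type*} [MetricSpace α]
    [CompleteSpace α] [TopologicalSpace β] [T2Space β] {f : α → β} (hf : Continuous f)
    {A : Set α} (hA : Preperfect A) (hne : A.Nonempty) (hfA : InjOn f A) :
    ∃ g : (ℕ → Bool) → α, Continuous g ∧ Function.Injective (f ∘ g) := by
  obtain ⟨u, -, hu, hlim⟩ := exists_seq_strictAnti_tendsto' (zero_lt_one' ENNReal)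
  choose C hC hCd using
    fun (P : {U : Set α // IsOpen U ∧ (U ∩ A).Nonempty}) (n : ℕ) =>
      exists_bool_refinement hf hA hfA P.2.1 P.2.2 (hu n).1
  let DP : List Bool → {U : Set α // IsOpen U ∧ (U ∩ A).Nonempty} := fun l =>
    List.rec ⟨univ, isOpen_univ, by simpa using hne⟩
      (fun a l P => ⟨C P l.length a, (hC P l.length a).1, (hC P l.length a).2.1⟩) l
  let D : List Bool → Set α := fun l => (DP l).1
  have hanti : CantorScheme.ClosureAntitone D := fun l a => (hC (DP l) l.length a).2.2.1
  have hdiam : CantorScheme.VanishingDiam D := by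
    intro x
    refine (tendsto_add_atTop_iff_nat 1).1 <|
      tendsto_of_tendsto_of_tendsto_of_le_of_le tendsto_const_nhds hlim
        (fun _ => zero_le) fun n => ?_
    calc Metric.ediam (D (PiNat.res x (n + 1)))
        ≤ u (PiNat.res x n).length := (hC (DP (PiNat.res x n)) (PiNat.res x n).length (x n)).2.2.2
      _ = u n := by rw [PiNat.res_length]
  have hdom : ∀ x, x ∈ (CantorScheme.inducedMap D).1 := fun x => by
    rw [hanti.map_of_vanishingDiam hdiam fun l => (DP l).2.2.mono inter_subset_left]
    exact mem_univ x
  refine ⟨fun x => (CantorScheme.inducedMap D).2 ⟨x, hdom x⟩,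
    hdiam.map_continuous.comp (by fun_prop), fun x y hxy => ?_⟩
  have hmem : ∀ z n, f ((CantorScheme.inducedMap D).2 ⟨z, hdom z⟩) ∈ f '' D (PiNat.res z n) :=
    fun z n => mem_image_of_mem f (CantorScheme.map_mem ⟨z, hdom z⟩ n)
  apply PiNat.res_injective
  ext n : 1
  induction n with
  | zero => simp
  | succ n ih =>
    have hx := hmem x (n + 1)
    have hy := hmem y (n + 1)
    rw [← show f _ = f _ from hxy, PiNat.res_succ, ← ih] at hy
    rw [PiNat.res_succ] at hx
    simp only [PiNat.res_succ, List.cons.injEq]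
    refine ⟨?_, ih⟩
    have hd := disjoint_left.1 (hCd (DP (PiNat.res x n)) (PiNat.res x n).length)
    cases hxn : x n <;> cases hyn : y n <;> rw [hxn] at hx <;> rw [hyn] at hy <;>
      first | rfl | exact (hd hx hy).elim | exact (hd hy hx).elim

/-- A continuous map on a Polish space that is injective on an uncountable set is injective on
a copy of the Cantor space. -/
theorem exists_continuous_comp_injective_of_injOn {α β : Type*} [TopologicalSpace α]
    [PolishSpace α] [TopologicalSpace β] [T2Space β] {f : α → β} (hf : Continuous f)
    {S : Set α} (hS : ¬ S.Countable) (hfS : InjOn f S) :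
    ∃ g : (ℕ → Bool) → α, Continuous g ∧ Function.Injective (f ∘ g) := by
  let := TopologicalSpace.upgradeIsCompletelyMetrizable α
  obtain ⟨D, hD, hne, -⟩ := exists_perfect_nonempty_of_isClosed_of_not_countable
    (α := S) isClosed_univ (by rwa [countable_univ_iff])
  refine exists_continuous_comp_injective_of_preperfect hf (A := Subtype.val '' D) ?_
    (hne.image _) (hfS.mono (by simp))
  rw [preperfect_iff_nhds]
  rintro _ ⟨x, hx, rfl⟩ U hU
  obtain ⟨y, ⟨hyU, hyD⟩, hyx⟩ :=
    preperfect_iff_nhds.1 hD.acc x hx _ (continuous_subtype_val.continuousAt hU)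
  exact ⟨y, ⟨hyU, mem_image_of_mem _ hyD⟩, Subtype.val_injective.ne hyx⟩

theorem perfectSet_range {g : Cantor → Cantor} (hg : Continuous g) (hi : Function.Injective g) :
    PerfectSet (range g) := by
  refine ⟨⟨(isCompact_range hg).isClosed, ?_⟩, range_nonempty g⟩
  rw [preperfect_iff_nhds]
  rintro _ ⟨a, rfl⟩ U hU
  have hlim : Tendsto (fun n => Function.update a n (!a n)) atTop (𝓝 a) := by
    rw [tendsto_pi_nhds]
    intro k
    refine tendsto_const_nhds.congr' ?_
    filter_upwards [eventually_gt_atTop k] with n hn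
    rw [Function.update_of_ne hn.ne]
  obtain ⟨n, hn⟩ := (hlim.eventually (hg.continuousAt hU)).exists
  refine ⟨_, ⟨hn, mem_range_self _⟩, hi.ne fun h => ?_⟩
  simpa using congrFun h n

/-- A Borel map on a perfect subset of Cantor space is injective or constant on some
perfect subset. -/
theorem perfect_inj_or_const (X : Set Cantor) (hX : PerfectSet X)
    (f : X → Cantor) (hf : Measurable f) :
    ∃ Y, Y ⊆ X ∧ PerfectSet Y ∧
      ((∀ x y : X, ↑x ∈ Y → ↑y ∈ Y → f x = f y → x = y) ∨
        (∃ c, ∀ x : X, ↑x ∈ Y → f x = c)) := by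
  have : TopologicalSpace.IsCompletelyMetrizableSpace Bool := inferInstance
  have : TopologicalSpace.IsCompletelyMetrizableSpace Cantor :=
    TopologicalSpace.IsCompletelyMetrizableSpace.pi_countable
  have : PolishSpace Cantor := inferInstance
  let := TopologicalSpace.upgradeIsCompletelyMetrizable Cantor
  have : PolishSpace X := hX.1.closed.polishSpace
  have hXunc : ¬ (univ : Set X).Countable := by
    obtain ⟨g, hgX, -, hg⟩ := hX.1.exists_nat_bool_injection hX.2
    have : Uncountable Cantor := by
      rw [← Cardinal.aleph0_lt_mk_iff]
      simpa [Cantor] using Cardinal.aleph0_lt_continuum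
    intro h
    have : Countable X := countable_univ_iff.1 h
    exact not_countable (α := Cantor) <|
      (show Function.Injective fun a => (⟨g a, hgX (mem_range_self a)⟩ : X) from
        fun a b hab => hg (congrArg Subtype.val hab)).countable
  obtain ⟨t, ht, hft, hpol⟩ := hf.exists_continuous
  have hval : Continuous[t, _] (Subtype.val : X → Cantor) :=
    continuous_le_dom ht continuous_subtype_val
  by_cases hfib : ∃ c, ¬ (f ⁻¹' {c}).Countable
  · obtain ⟨c, hc⟩ := hfib
    obtain ⟨g, hgc, hg, hgi⟩ := @IsClosed.exists_nat_bool_injection_of_not_countable _ t hpol _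
      (isClosed_singleton.preimage hft) hc
    refine ⟨range (Subtype.val ∘ g), ?_, perfectSet_range (hval.comp hg)
      (Subtype.val_injective.comp hgi), Or.inr ⟨c, ?_⟩⟩
    · rintro _ ⟨a, rfl⟩
      exact (g a).2
    · rintro x ⟨a, ha⟩
      obtain rfl : g a = x := Subtype.ext ha
      exact hgc (mem_range_self a)
  · push Not at hfib
    obtain ⟨S, -, hS⟩ := exists_subset_bijOn univ f
    have hSunc : ¬ S.Countable := fun h => hXunc <| by
      have hr := h.image f
      rw [hS.image_eq] at hr
      refine (hr.biUnion fun c _ => hfib c).mono fun x _ => ?_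
      exact mem_biUnion (mem_image_of_mem f (mem_univ x)) (mem_singleton (f x))
    obtain ⟨g, hg, hgi⟩ := @exists_continuous_comp_injective_of_injOn _ _ t hpol _ _ _ hft _ hSunc
      hS.injOn
    refine ⟨range (Subtype.val ∘ g), ?_, perfectSet_range (hval.comp hg)
      (Subtype.val_injective.comp hgi.of_comp), Or.inl ?_⟩
    · rintro _ ⟨a, rfl⟩
      exact (g a).2
    · rintro x y ⟨a, ha⟩ ⟨b, hb⟩ hxy
      obtain rfl : g a = x := Subtype.ext ha
      obtain rfl : g b = y := Subtype.ext hb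
      rw [hgi hxy]
end

section
/- Canonization for E₀-large sets: Suppose that E is a Borel equivalence relation on 2^ω and X ⊆ 2^ω is a Borel E₀-large set. Then there is a canonical E₀-large set Y ⊆ X such that E coincides on Y either (I) with the total equivalence relation, or (II) with the relation E₀, or (III) with equality. In addition, if E is a countable equivalence relation then case (I) is impossible, while if E₀ ⊆ E then case (III) is impossible. -/
open MeasureTheory

section Canonization

open Set Filter Topology

/-! ### Finite modifications of points -/

/-- Flip the coordinates of `x` that belong to the finite set `g`. -/
def flipOn (g : Finset ℕ) (x : Cantor) : Cantor := fun k => xor (x k) (decide (k ∈ g))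

lemma flipOn_of_mem {g : Finset ℕ} {k : ℕ} (hk : k ∈ g) (x : Cantor) :
    flipOn g x k = !(x k) := by
  simp [flipOn, hk]

lemma flipOn_of_notMem {g : Finset ℕ} {k : ℕ} (hk : k ∉ g) (x : Cantor) :
    flipOn g x k = x k := by
  simp [flipOn, hk]

@[simp] lemma flipOn_empty (x : Cantor) : flipOn ∅ x = x := by
  funext k
  simp [flipOn]

@[simp] lemma flipOn_flipOn_self (g : Finset ℕ) (x : Cantor) : flipOn g (flipOn g x) = x := by
  funext k
  simp [flipOn]

lemma flipOn_symmDiff (g h : Finset ℕ) (x : Cantor) :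
    flipOn (symmDiff g h) x = flipOn g (flipOn h x) := by
  funext k
  by_cases h1 : k ∈ g <;> by_cases h2 : k ∈ h <;> simp [flipOn, Finset.mem_symmDiff, h1, h2]

lemma flipOn_comm (g h : Finset ℕ) (x : Cantor) :
    flipOn g (flipOn h x) = flipOn h (flipOn g x) := by
  rw [← flipOn_symmDiff, ← flipOn_symmDiff, symmDiff_comm]

lemma flipOn_ne {g : Finset ℕ} (hg : g.Nonempty) (x : Cantor) : flipOn g x ≠ x := by
  obtain ⟨k, hk⟩ := hg
  intro h
  have := congrFun h k
  simp [flipOn_of_mem hk] at this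

lemma continuous_flipOn (g : Finset ℕ) : Continuous (flipOn g) :=
  continuous_pi fun k =>
    (continuous_of_discreteTopology (f := fun b : Bool => xor b (decide (k ∈ g)))).comp
      (continuous_apply k)

/-- Flipping the coordinates in `g`, as a homeomorphism. -/
def flipHomeo (g : Finset ℕ) : Cantor ≃ₜ Cantor where
  toFun := flipOn g
  invFun := flipOn g
  left_inv := flipOn_flipOn_self g
  right_inv := flipOn_flipOn_self g
  continuous_toFun := continuous_flipOn g
  continuous_invFun := continuous_flipOn g

lemma measurable_flipOn (g : Finset ℕ) : Measurable (flipOn g) := (continuous_flipOn g).measurable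

lemma eZero_iff_flipOn {x y : Cantor} : eZero x y ↔ ∃ g, y = flipOn g x := by
  constructor
  · intro h
    refine ⟨h.toFinset, funext fun k => ?_⟩
    by_cases hk : x k = y k
    · rw [flipOn_of_notMem (fun h' => h.mem_toFinset.1 h' hk), hk]
    · rw [flipOn_of_mem (h.mem_toFinset.2 hk)]
      cases hx : x k <;> cases hy : y k <;> simp_all
  · rintro ⟨g, rfl⟩
    refine g.finite_toSet.subset fun k hk => ?_
    by_contra h
    exact hk (flipOn_of_notMem h x).symm

lemma eZero_symm {x y : Cantor} (h : eZero x y) : eZero y x := by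
  simpa only [eZero, ne_comm] using h

lemma eZero_trans {x y z : Cantor} (h : eZero x y) (h' : eZero y z) : eZero x z := by
  obtain ⟨g, rfl⟩ := eZero_iff_flipOn.1 h
  obtain ⟨g', rfl⟩ := eZero_iff_flipOn.1 h'
  exact eZero_iff_flipOn.2 ⟨symmDiff g' g, (flipOn_symmDiff _ _ _).symm⟩

lemma eZero_iff_eventually {x y : Cantor} : eZero x y ↔ ∃ n, ∀ k, n ≤ k → x k = y k := by
  constructor
  · intro h
    obtain ⟨n, hn⟩ := h.bddAbove
    refine ⟨n + 1, fun k hk => ?_⟩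
    by_contra hne
    have : k ≤ n := hn hne
    omega
  · rintro ⟨n, hn⟩
    refine (Set.finite_Iio n).subset fun k hk => ?_
    by_contra h
    exact hk (hn k (not_lt.1 h))

/-! ### Basic clopen sets -/

/-- The set of points that agree with `x` below `n`. -/
def cyl (x : Cantor) (n : ℕ) : Set Cantor := {y | ∀ k < n, y k = x k}

lemma mem_cyl_self (x : Cantor) (n : ℕ) : x ∈ cyl x n := fun _ _ => rfl

lemma isClopen_cyl (x : Cantor) (n : ℕ) : IsClopen (cyl x n) := by
  have : cyl x n = ⋂ k ∈ Finset.range n, (fun y : Cantor => y k) ⁻¹' {x k} := by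
    ext y
    simp [cyl]
  rw [this]
  exact isClopen_biInter_finset fun k _ =>
    (isClopen_discrete _).preimage (continuous_apply k)

lemma cyl_anti (x : Cantor) {m n : ℕ} (h : m ≤ n) : cyl x n ⊆ cyl x m :=
  fun _ hy k hk => hy k (hk.trans_le h)

lemma exists_cyl_subset {x : Cantor} {U : Set Cantor} (hU : IsOpen U) (hx : x ∈ U) :
    ∃ n, cyl x n ⊆ U := by
  obtain ⟨I, u, hu, hIU⟩ := isOpen_pi_iff.1 hU x hx
  refine ⟨I.sup id + 1, fun y hy => hIU fun k hk => ?_⟩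
  rw [hy k (Nat.lt_succ_of_le (Finset.le_sup (f := id) hk))]
  exact (hu k hk).2

/-! ### Canonical embeddings -/

/-- `h` is a canonical embedding with blocks `[m n, m (n + 1))`: the `n`-th block of `h a`
depends exactly on `a n`. -/
structure IsCanon (h : Cantor → Cantor) (m : ℕ → ℕ) : Prop where
  mono : StrictMono m
  zero : m 0 = 0
  local_eq : ∀ a b n, a n = b n → ∀ k, m n ≤ k → k < m (n + 1) → h a k = h b k
  sep : ∀ a b n, a n ≠ b n → ∃ k, m n ≤ k ∧ k < m (n + 1) ∧ h a k ≠ h b k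

lemma exists_block {m : ℕ → ℕ} (hm : StrictMono m) (h0 : m 0 = 0) (k : ℕ) :
    ∃ n, m n ≤ k ∧ k < m (n + 1) := by
  induction k with
  | zero => exact ⟨0, h0.le, by have := hm (lt_add_one 0); omega⟩
  | succ k ih =>
    obtain ⟨n, h1, h2⟩ := ih
    rcases Nat.lt_or_ge (k + 1) (m (n + 1)) with h | h
    · exact ⟨n, by omega, h⟩
    · exact ⟨n + 1, h, by have := hm (lt_add_one (n + 1)); omega⟩

namespace IsCanon

variable {h : Cantor → Cantor} {m : ℕ → ℕ}

lemma comp (H : IsCanon h m) {h' : Cantor → Cantor} {m' : ℕ → ℕ} (H' : IsCanon h' m') :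
    IsCanon (h ∘ h') (m ∘ m') where
  mono := H.mono.comp H'.mono
  zero := by simp [H'.zero, H.zero]
  local_eq a b n hab k hk hk' := by
    obtain ⟨j, hj, hj'⟩ := exists_block H.mono H.zero k
    refine H.local_eq _ _ j (H'.local_eq a b n hab j ?_ ?_) k hj hj'
    · exact Nat.lt_succ_iff.1 (H.mono.lt_iff_lt.1 (hk.trans_lt hj'))
    · exact H.mono.lt_iff_lt.1 (hj.trans_lt hk')
  sep a b n hab := by
    obtain ⟨j, hj, hj', hne⟩ := H'.sep a b n hab
    obtain ⟨k, hk, hk', hne'⟩ := H.sep _ _ j hne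
    exact ⟨k, (H.mono.monotone hj).trans hk, hk'.trans_le (H.mono.monotone hj'), hne'⟩

lemma continuous (H : IsCanon h m) : Continuous h := by
  refine continuous_pi fun k => ?_
  obtain ⟨n, hn, hn'⟩ := exists_block H.mono H.zero k
  have : (fun a => h a k) = (fun i : Bool => h (fun _ => i) k) ∘ fun a => a n := by
    funext a
    exact H.local_eq a (fun _ => a n) n rfl k hn hn'
  rw [this]
  exact continuous_of_discreteTopology.comp (continuous_apply n)

lemma injective (H : IsCanon h m) : Function.Injective h := by
  intro a b hab
  by_contra hne
  obtain ⟨n, hn⟩ := Function.ne_iff.1 hne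
  obtain ⟨k, -, -, hk⟩ := H.sep a b n hn
  exact hk (congrFun hab k)

lemma eZero_iff (H : IsCanon h m) (a b : Cantor) : eZero (h a) (h b) ↔ eZero a b := by
  simp only [eZero_iff_eventually]
  constructor
  · rintro ⟨N, hN⟩
    refine ⟨N, fun n hn => ?_⟩
    by_contra hne
    obtain ⟨k, hk, -, hk'⟩ := H.sep a b n hne
    exact hk' (hN k (hn.trans ((H.mono.id_le n).trans hk)))
  · rintro ⟨N, hN⟩
    refine ⟨m N, fun k hk => ?_⟩
    obtain ⟨n, hn, hn'⟩ := exists_block H.mono H.zero k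
    exact H.local_eq a b n (hN n (Nat.lt_succ_iff.1 (H.mono.lt_iff_lt.1 (hk.trans_lt hn')))) k
      hn hn'

lemma exists_array (H : IsCanon h m) : ∃ U : E0Array, xua U = h := by
  have hm : ∀ n, m n < m (n + 1) := fun n => H.mono (Nat.lt_succ_self n)
  refine ⟨⟨fun n i => (List.range' (m n) (m (n + 1) - m n)).map (h fun _ => i),
    fun n => by simp, fun n => by have := hm n; simp; omega, fun n he => ?_⟩, ?_⟩
  · obtain ⟨k, hk, hk', hne⟩ := H.sep (fun _ => false) (fun _ => true) n (by simp)
    refine hne (List.map_inj_left.1 he k ?_)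
    rw [List.mem_range'_1]
    omega
  · funext a k
    have key : ∀ N, ((List.range N).map fun n =>
        (List.range' (m n) (m (n + 1) - m n)).map (h fun _ => a n)).flatten
          = (List.range' 0 (m N)).map (h a) := by
      intro N
      induction N with
      | zero => simp [H.zero]
      | succ N ih =>
        have hb : (List.range' (m N) (m (N + 1) - m N)).map (h fun _ => a N)
            = (List.range' (m N) (m (N + 1) - m N)).map (h a) := by
          refine List.map_congr_left fun j hj => ?_
          rw [List.mem_range'_1] at hj
          exact H.local_eq (fun _ => a N) a N rfl j hj.1 (by omega)
        have hs : m (N + 1) = m N + (m (N + 1) - m N) := by have := hm N; omega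
        rw [List.range_succ, List.map_append, List.flatten_append, ih, List.map_singleton,
          List.flatten_singleton, hb, ← List.map_append]
        conv_rhs => rw [hs, ← List.range'_append_1]
        simp
    have hk : k < m (k + 1) := (Nat.lt_succ_self k).trans_le (H.mono.id_le (k + 1))
    simp only [xua, key]
    simp [List.getD_eq_getElem?_getD, hk]

end IsCanon

/-! ### Fusion -/

/-- The finite modification coded by the first `n` digits of `a`. -/
def pat (g : ℕ → Finset ℕ) (a : Cantor) : ℕ → Finset ℕ
  | 0 => ∅
  | n + 1 => if a n then symmDiff (g n) (pat g a n) else pat g a n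

lemma pat_succ_of_true {g : ℕ → Finset ℕ} {a : Cantor} {n : ℕ} (h : a n = true) :
    pat g a (n + 1) = symmDiff (g n) (pat g a n) := by
  simp [pat, h]

lemma pat_succ_of_false {g : ℕ → Finset ℕ} {a : Cantor} {n : ℕ} (h : a n = false) :
    pat g a (n + 1) = pat g a n := by
  simp [pat, h]

lemma pat_succ_mem {g : ℕ → Finset ℕ} {a : Cantor} {n : ℕ} {G : Finset (Finset ℕ)}
    (h : pat g a n ∈ G) : pat g a (n + 1) ∈ G ∪ G.image (symmDiff (g n)) := by
  cases ha : a n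
  · rw [pat_succ_of_false ha]
    exact Finset.mem_union_left _ h
  · rw [pat_succ_of_true ha]
    exact Finset.mem_union_right _ (Finset.mem_image_of_mem _ h)

lemma flipOn_pat_tail (g : ℕ → Finset ℕ) {a b : Cantor} {n : ℕ} (hab : ∀ k, n ≤ k → a k = b k)
    {N : ℕ} (hN : n ≤ N) (x : Cantor) :
    flipOn (pat g a n) (flipOn (pat g a N) x) = flipOn (pat g b n) (flipOn (pat g b N) x) := by
  induction N, hN using Nat.le_induction with
  | base => simp
  | succ N hN ih =>
    cases h : a N
    · rw [pat_succ_of_false h, pat_succ_of_false ((hab N hN).symm.trans h), ih]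
    · rw [pat_succ_of_true h, pat_succ_of_true ((hab N hN).symm.trans h), flipOn_symmDiff,
        flipOn_symmDiff, flipOn_comm _ (g N), ih, flipOn_comm (g N)]

/-- A fusion sequence: the sets `A n` shrink and are mapped into each other by the finite
modifications `g n`, so that they determine the canonical embedding `h`. -/
structure IsFusion (h : Cantor → Cantor) (m : ℕ → ℕ) (A : ℕ → Set Cantor) (g : ℕ → Finset ℕ) :
    Prop where
  canon : IsCanon h m
  nest : ∀ a n y, flipOn (pat g a (n + 1)) y ∈ A (n + 1) → flipOn (pat g a n) y ∈ A n
  agree : ∀ a n y, flipOn (pat g a n) y ∈ A n → ∀ k < m n, y k = h a k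
  mem_closure : ∀ a n, flipOn (pat g a n) (h a) ∈ closure (A n)
  tail : ∀ a b n, (∀ k, n ≤ k → a k = b k) →
    flipOn (pat g a n) (h a) = flipOn (pat g b n) (h b)

lemma IsFusion.mem_of_le {h : Cantor → Cantor} {m : ℕ → ℕ} {A : ℕ → Set Cantor}
    {g : ℕ → Finset ℕ} (H : IsFusion h m A g) {a : Cantor} {n N : ℕ} (hnN : n ≤ N) {y : Cantor}
    (hy : flipOn (pat g a N) y ∈ A N) : flipOn (pat g a n) y ∈ A n := by
  induction N, hnN using Nat.le_induction with
  | base => exact hy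
  | succ N _ ih => exact ih (H.nest a N y hy)

lemma exists_isFusion {m : ℕ → ℕ} {A : ℕ → Set Cantor} {g : ℕ → Finset ℕ} (hm : StrictMono m)
    (hm0 : m 0 = 0) (hA : ∀ n, (A n).Nonempty) (hg : ∀ n, (g n).Nonempty)
    (hgm : ∀ n, ∀ k ∈ g n, k < m (n + 1))
    (hAA : ∀ n, A (n + 1) ⊆ A n) (hgA : ∀ n, ∀ x ∈ A (n + 1), flipOn (g n) x ∈ A n)
    (hag : ∀ n, ∀ x ∈ A n, ∀ y ∈ A n, ∀ k < m n, x k = y k) :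
    ∃ h, IsFusion h m A g := by
  choose z hz using hA
  have nest : ∀ a n y, flipOn (pat g a (n + 1)) y ∈ A (n + 1) → flipOn (pat g a n) y ∈ A n := by
    intro a n y hy
    cases h : a n
    · rw [pat_succ_of_false h] at hy
      exact hAA n hy
    · rw [pat_succ_of_true h, flipOn_symmDiff] at hy
      simpa using hgA n _ hy
  have nest' : ∀ a n N y, n ≤ N → flipOn (pat g a N) y ∈ A N → flipOn (pat g a n) y ∈ A n := by
    intro a n N y hnN
    induction N, hnN using Nat.le_induction with
    | base => exact id
    | succ N _ ih => exact fun hy => ih (nest a N y hy)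
  set Y : Cantor → ℕ → Cantor := fun a n => flipOn (pat g a n) (z n) with hY
  have hYmem : ∀ a n, flipOn (pat g a n) (Y a n) ∈ A n := fun a n => by simpa [hY] using hz n
  have two : ∀ a n y y', flipOn (pat g a n) y ∈ A n → flipOn (pat g a n) y' ∈ A n →
      ∀ k < m n, y k = y' k := by
    intro a n y y' hy hy' k hk
    simpa [flipOn] using hag n _ hy _ hy' k hk
  have hmk : ∀ k, k < m (k + 1) := fun k => (Nat.lt_succ_self k).trans_le (hm.id_le (k + 1))
  have agree : ∀ a n y, flipOn (pat g a n) y ∈ A n → ∀ k < m n, y k = Y a (k + 1) k := by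
    intro a n y hy k hk
    have h1 := nest' a n (max n (k + 1)) _ (le_max_left _ _) (hYmem a _)
    have h2 := nest' a (k + 1) (max n (k + 1)) _ (le_max_right _ _) (hYmem a _)
    exact (two a n _ _ hy h1 k hk).trans (two a (k + 1) _ _ h2 (hYmem a _) k (hmk k))
  have Yeq : ∀ a n k, k < m n → Y a (k + 1) k = Y a n k := fun a n k hk =>
    (agree a n _ (hYmem a n) k hk).symm
  have bound : ∀ a n, ∀ k ∈ pat g a n, k < m n := by
    intro a n
    induction n with
    | zero => simp [pat]
    | succ n ih =>
      intro k hk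
      cases h : a n
      · rw [pat_succ_of_false h] at hk
        exact (ih k hk).trans (hm (Nat.lt_succ_self n))
      · rw [pat_succ_of_true h, Finset.mem_symmDiff] at hk
        rcases hk with hk | hk
        · exact hgm n k hk.1
        · exact (ih k hk.1).trans (hm (Nat.lt_succ_self n))
  have block : ∀ a n k, m n ≤ k → k < m (n + 1) →
      Y a (k + 1) k = xor (z (n + 1) k) (a n && decide (k ∈ g n)) := by
    intro a n k hk hk'
    have hnot : k ∉ pat g a n := fun h => (bound a n k h).not_ge hk
    rw [Yeq a (n + 1) k hk']
    cases h : a n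
    · simp [hY, pat_succ_of_false h, flipOn, hnot]
    · simp [hY, pat_succ_of_true h, flipOn, hnot, Finset.mem_symmDiff]
  refine ⟨fun a k => Y a (k + 1) k, ⟨hm, hm0, ?_, ?_⟩, nest, agree, ?_, ?_⟩
  · intro a b n hab k hk hk'
    simp only [block _ n k hk hk', hab]
  · intro a b n hab
    obtain ⟨k, hk⟩ := hg n
    have hk1 : m n ≤ k := by
      by_contra hlt
      have := hag n _ (hgA n _ (hz (n + 1))) _ (hAA n (hz (n + 1))) k (not_le.1 hlt)
      simp [flipOn_of_mem hk] at this
    refine ⟨k, hk1, hgm n k hk, ?_⟩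
    rw [block _ n k hk1 (hgm n k hk), block _ n k hk1 (hgm n k hk)]
    cases ha : a n <;> cases hb : b n <;> simp_all
  · intro a n
    have ht : Tendsto (Y a) atTop (𝓝 fun k => Y a (k + 1) k) := by
      rw [tendsto_pi_nhds]
      intro k
      refine tendsto_const_nhds.congr' ?_
      filter_upwards [eventually_ge_atTop (k + 1)] with N hN
      exact Yeq a N k ((hmk k).trans_le (hm.monotone hN))
    refine mem_closure_of_tendsto (((continuous_flipOn (pat g a n)).tendsto _).comp ht) ?_
    filter_upwards [eventually_ge_atTop n] with N hN
    exact nest' a n N _ hN (hYmem a N)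
  · intro a b n hab
    funext k
    have h := congrFun (flipOn_pat_tail g hab (le_max_left n (k + 1)) (z (max n (k + 1)))) k
    have hk : k < m (max n (k + 1)) := (hmk k).trans_le (hm.monotone (le_max_right _ _))
    simp only [flipOn] at h ⊢
    rw [Yeq a _ k hk, Yeq b _ k hk]
    simpa only [hY, flipOn] using h

/-- The general fusion construction. The finite set `G` collects all modifications
`pat g a n` at stage `n`. -/
lemma fusion (P : Set Cantor → Prop) (R : ℕ → Finset (Finset ℕ) → Finset ℕ → Set Cantor → Prop)
    (hne : ∀ A, P A → A.Nonempty) {A₀ : Set Cantor} (hA₀ : P A₀)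
    (step : ∀ n A G, P A → ∃ g : Finset ℕ, g.Nonempty ∧ ∀ M : ℕ, ∃ A', P A' ∧ A' ⊆ A ∧
      (∀ x ∈ A', flipOn g x ∈ A) ∧ R n G g A' ∧ ∀ x ∈ A', ∀ y ∈ A', ∀ k < M, x k = y k) :
    ∃ (h : Cantor → Cantor) (m : ℕ → ℕ) (A : ℕ → Set Cantor) (g : ℕ → Finset ℕ)
      (G : ℕ → Finset (Finset ℕ)), IsFusion h m A g ∧ A 0 = A₀ ∧ (∀ n, P (A n)) ∧
      (∀ n, R n (G n) (g n) (A (n + 1))) ∧ ∀ a n, pat g a n ∈ G n := by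
  classical
  have step' : ∀ (n : ℕ) (s : {A // P A} × Finset (Finset ℕ) × ℕ),
      ∃ (g : Finset ℕ) (s' : {A // P A} × Finset (Finset ℕ) × ℕ), g.Nonempty ∧
        s'.1.1 ⊆ s.1.1 ∧ (∀ x ∈ s'.1.1, flipOn g x ∈ s.1.1) ∧ R n s.2.1 g s'.1.1 ∧
        s'.2.1 = s.2.1 ∪ s.2.1.image (symmDiff g) ∧ s.2.2 < s'.2.2 ∧
        (∀ k ∈ g, k < s'.2.2) ∧ ∀ x ∈ s'.1.1, ∀ y ∈ s'.1.1, ∀ k < s'.2.2, x k = y k := by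
    rintro n ⟨⟨A, hA⟩, G, M⟩
    obtain ⟨g, hg, H⟩ := step n A G hA
    obtain ⟨A', hA', h1, h2, h3, h4⟩ := H (max M (g.sup id) + 1)
    refine ⟨g, ⟨⟨A', hA'⟩, _, _⟩, hg, h1, h2, h3, rfl, ?_, fun k hk => ?_, h4⟩
    · exact Nat.lt_succ_of_le (le_max_left _ _)
    · exact Nat.lt_succ_of_le ((Finset.le_sup (f := id) hk).trans (le_max_right _ _))
  choose gf sf hgf h1 h2 h3 h4 h5 h6 h7 using step'
  let s : ℕ → {A // P A} × Finset (Finset ℕ) × ℕ := fun n =>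
    Nat.rec ⟨⟨A₀, hA₀⟩, {∅}, 0⟩ (fun n s => sf n s) n
  obtain ⟨h, hh⟩ := exists_isFusion (m := fun n => (s n).2.2) (A := fun n => (s n).1.1)
    (g := fun n => gf n (s n)) (strictMono_nat_of_lt_succ fun n => h5 n (s n)) rfl
    (fun n => hne _ (s n).1.2) (fun n => hgf n (s n)) (fun n => h6 n (s n))
    (fun n => h1 n (s n)) (fun n => h2 n (s n)) (by
      rintro (_ | n)
      · intro _ _ _ _ k hk
        exact absurd hk (Nat.not_lt_zero k)
      · exact h7 n (s n))
  refine ⟨h, _, _, _, fun n => (s n).2.1, hh, rfl, fun n => (s n).1.2, fun n => h3 n (s n), ?_⟩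
  intro a n
  induction n with
  | zero => exact Finset.mem_singleton_self _
  | succ n ih =>
    have : (s (n + 1)).2.1 = _ := h4 n (s n)
    change _ ∈ (s (n + 1)).2.1
    rw [this, Finset.mem_union]
    cases ha : a n
    · rw [pat_succ_of_false ha]
      exact Or.inl ih
    · rw [pat_succ_of_true ha]
      exact Or.inr (Finset.mem_image_of_mem _ ih)

/-! ### Canonical sets inside `E₀`-large sets -/

/-- `T` meets every `E₀`-class in at most one point. -/
def IsTransversal (T : Set Cantor) : Prop :=
  ∀ x ∈ T, ∀ g : Finset ℕ, g.Nonempty → flipOn g x ∉ T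

/-- `A` is covered by countably many Borel partial transversals of `E₀`. -/
def Thin (A : Set Cantor) : Prop :=
  ∃ 𝒯 : Set (Set Cantor), 𝒯.Countable ∧ (∀ T ∈ 𝒯, MeasurableSet T ∧ IsTransversal T) ∧ A ⊆ ⋃₀ 𝒯

lemma thin_of_subset_iUnion {ι : Type*} [Countable ι] {A : Set Cantor} {B : ι → Set Cantor}
    (hB : ∀ i, Thin (B i)) (hA : A ⊆ ⋃ i, B i) : Thin A := by
  choose 𝒯 h1 h2 h3 using hB
  refine ⟨⋃ i, 𝒯 i, countable_iUnion h1, ?_, hA.trans (iUnion_subset fun i => ?_)⟩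
  · intro T hT
    obtain ⟨i, hi⟩ := mem_iUnion.1 hT
    exact h2 i T hi
  · exact (h3 i).trans (sUnion_subset_sUnion (subset_iUnion 𝒯 i))

lemma Thin.of_isTransversal {T : Set Cantor} (hT : MeasurableSet T) (hT' : IsTransversal T) :
    Thin T :=
  ⟨{T}, countable_singleton T, by simp [hT, hT'], by simp⟩

lemma exists_not_thin_inter {ι : Type*} [Countable ι] {A : Set Cantor} (hA : ¬ Thin A)
    {B : ι → Set Cantor} (hB : A ⊆ ⋃ i, B i) : ∃ i, ¬ Thin (A ∩ B i) := by
  by_contra! h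
  exact hA (thin_of_subset_iUnion h (by rw [← inter_iUnion]; exact subset_inter subset_rfl hB))

lemma exists_not_thin_flipOn {A : Set Cantor} (hA : ¬ Thin A) (hAm : MeasurableSet A) :
    ∃ g : Finset ℕ, g.Nonempty ∧ ¬ Thin (A ∩ flipOn g ⁻¹' A) := by
  by_contra! h
  let S : Finset ℕ → Set Cantor := fun g => if g.Nonempty then A ∩ flipOn g ⁻¹' A else ∅
  have hS : ∀ g, Thin (S g) := by
    intro g
    by_cases hg : g.Nonempty
    · simpa [S, hg] using h g hg
    · exact ⟨∅, countable_empty, by simp, by simp [S, hg]⟩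
  have hSm : ∀ g, MeasurableSet (S g) := by
    intro g
    by_cases hg : g.Nonempty
    · simpa [S, hg] using hAm.inter (measurable_flipOn g hAm)
    · simp [S, hg]
  have hT : Thin (A \ ⋃ g, S g) := by
    refine Thin.of_isTransversal (hAm.diff (MeasurableSet.iUnion hSm)) ?_
    intro x hx g hg hx'
    exact hx.2 (mem_iUnion.2 ⟨g, by simpa [S, hg] using ⟨hx.1, hx'.1⟩⟩)
  refine hA (thin_of_subset_iUnion (B := fun b : Bool => if b then A \ ⋃ g, S g else ⋃ g, S g)
    ?_ ?_)
  · rintro (_ | _)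
    · simpa using thin_of_subset_iUnion hS subset_rfl
    · simpa using hT
  · intro x hx
    by_cases hx' : x ∈ ⋃ g, S g
    · exact mem_iUnion.2 ⟨false, by simpa using hx'⟩
    · exact mem_iUnion.2 ⟨true, by simpa using ⟨hx, by simpa using hx'⟩⟩

lemma relSmoothOn_of_thin {X : Set Cantor} (hX : Thin X) : RelSmoothOn eZero X := by
  obtain ⟨𝒯, hc, h𝒯, hX𝒯⟩ := hX
  obtain ⟨T, hT⟩ := (hc.insert ∅).exists_eq_range (insert_nonempty ∅ 𝒯)
  have hT' : ∀ n, MeasurableSet (T n) ∧ IsTransversal (T n) := by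
    intro n
    rcases hT.symm ▸ mem_range_self n with h | h
    · rw [h]
      exact ⟨MeasurableSet.empty, fun x hx => hx.elim⟩
    · exact h𝒯 _ h
  have hXT : ∀ x ∈ X, ∃ n, x ∈ T n := by
    intro x hx
    obtain ⟨S, hS, hxS⟩ := hX𝒯 hx
    obtain ⟨n, rfl⟩ : S ∈ range T := hT ▸ mem_insert_of_mem _ hS
    exact ⟨n, hxS⟩
  -- `D` is a Borel transversal that meets every class meeting `X`
  let D : Set Cantor := ⋃ n, T n \ ⋃ (j : Fin n), ⋃ g, flipOn g ⁻¹' T j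
  have hDm : MeasurableSet D := MeasurableSet.iUnion fun n => (hT' n).1.diff <|
    MeasurableSet.iUnion fun j => MeasurableSet.iUnion fun g => measurable_flipOn g (hT' j).1
  have hD : ∀ x ∈ D, ∀ y ∈ D, eZero x y → x = y := by
    intro x hx y hy hxy
    obtain ⟨g, rfl⟩ := eZero_iff_flipOn.1 hxy
    obtain ⟨n, hn, hn'⟩ := mem_iUnion.1 hx
    obtain ⟨k, hk, hk'⟩ := mem_iUnion.1 hy
    simp only [mem_iUnion, mem_preimage, not_exists] at hn' hk'
    rcases lt_trichotomy n k with h | rfl | h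
    · exact absurd (by simpa using hn) (hk' ⟨n, h⟩ g)
    · rcases g.eq_empty_or_nonempty with rfl | hg
      · simp
      · exact absurd hk ((hT' n).2 x hn g hg)
    · exact absurd hk (hn' ⟨k, h⟩ g)
  have hex : ∀ x ∈ X, ∃ g, flipOn g x ∈ D := by
    classical
    intro x hx
    have hx' : ∃ n, ∃ g, flipOn g x ∈ T n := by
      obtain ⟨n, hn⟩ := hXT x hx
      exact ⟨n, ∅, by simpa using hn⟩
    obtain ⟨g, hg⟩ := Nat.find_spec hx'
    refine ⟨g, mem_iUnion.2 ⟨Nat.find hx', hg, ?_⟩⟩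
    simp only [mem_iUnion, mem_preimage, not_exists]
    intro j g' hg'
    exact Nat.find_min hx' j.2 ⟨symmDiff g' g, by rwa [flipOn_symmDiff]⟩
  choose! γ hγ using hex
  have hself : ∀ g x, eZero x (flipOn g x) := fun g x => eZero_iff_flipOn.2 ⟨g, rfl⟩
  refine ⟨fun x => flipOn (γ x) x, ?_, fun x y => ⟨fun h => ?_, fun h => ?_⟩⟩
  · intro S hS
    have : (fun x : X => flipOn (γ x) (x : Cantor)) ⁻¹' S
        = ⋃ g, Subtype.val ⁻¹' (flipOn g ⁻¹' (D ∩ S)) := by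
      ext x
      simp only [mem_preimage, mem_iUnion]
      refine ⟨fun h => ⟨γ x, hγ x x.2, h⟩, fun ⟨g, hg, hg'⟩ => ?_⟩
      rwa [← hD _ hg _ (hγ x x.2) (eZero_trans (eZero_symm (hself g x)) (hself _ _))]
    rw [this]
    exact MeasurableSet.iUnion fun g =>
      measurable_subtype_coe (measurable_flipOn g (hDm.inter hS))
  · exact hD _ (hγ x x.2) _ (hγ y y.2)
      (eZero_trans (eZero_symm (hself _ _)) (eZero_trans h (hself _ _)))
  · have hxy : flipOn (γ x) (x : Cantor) = flipOn (γ y) (y : Cantor) := h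
    exact eZero_trans (hself (γ x) x) (hxy ▸ eZero_symm (hself (γ y) y))

lemma exists_scheme_range {β : Type*} [TopologicalSpace β] [PolishSpace β] {f : β → Cantor}
    (hf : Continuous f) (hinj : Function.Injective f) :
    ∃ V : ℕ → ℕ → Set Cantor, (∀ n k, MeasurableSet (V n k)) ∧ (∀ n, range f ⊆ ⋃ k, V n k) ∧
      ∀ (k : ℕ → ℕ) (y : ℕ → Cantor) (x : Cantor), (∀ n, ∀ j ≤ n, y n ∈ V j (k j)) →
        Tendsto y atTop (𝓝 x) → x ∈ range f := by
  rcases isEmpty_or_nonempty β with hβ | hβ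
  · refine ⟨fun _ _ => ∅, by simp, by simp [range_eq_empty], fun k y x h _ => (h 0 0 le_rfl).elim⟩
  let := TopologicalSpace.upgradeIsCompletelyMetrizable β
  refine ⟨fun n k => f '' Metric.closedBall (TopologicalSpace.denseSeq β k) ((1 / 2 : ℝ) ^ n),
    fun n k => Metric.isClosed_closedBall.measurableSet_image_of_continuousOn_injOn
      hf.continuousOn hinj.injOn, ?_, ?_⟩
  · rintro n _ ⟨b, rfl⟩
    obtain ⟨k, hk⟩ := (TopologicalSpace.denseRange_denseSeq β).exists_dist_lt b
      (show (0 : ℝ) < (1 / 2) ^ n by positivity)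
    exact mem_iUnion.2 ⟨k, b, hk.le, rfl⟩
  · intro k y x hy hx
    have hyr : ∀ n, ∃ b, f b = y n := fun n => by
      obtain ⟨b, -, hb⟩ := hy n 0 (Nat.zero_le n)
      exact ⟨b, hb⟩
    choose b hb using hyr
    have hmem : ∀ n, ∀ j ≤ n, b n ∈ Metric.closedBall (TopologicalSpace.denseSeq β (k j))
        ((1 / 2 : ℝ) ^ j) := by
      intro n j hj
      obtain ⟨c, hc, hc'⟩ := hy n j hj
      rwa [← hinj (hc'.trans (hb n).symm)]
    have hlim : Tendsto (fun n : ℕ => 2 * (1 / 2 : ℝ) ^ n) atTop (𝓝 0) := by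
      simpa using (tendsto_pow_atTop_nhds_zero_of_lt_one (r := (1 / 2 : ℝ)) (by norm_num)
        (by norm_num)).const_mul 2
    have hcau : CauchySeq b := by
      refine cauchySeq_of_le_tendsto_0 (fun n => 2 * (1 / 2 : ℝ) ^ n) (fun n m N hn hm => ?_) hlim
      refine (dist_triangle_right _ _ (TopologicalSpace.denseSeq β (k N))).trans ?_
      have h1 := Metric.mem_closedBall.1 (hmem n N hn)
      have h2 := Metric.mem_closedBall.1 (hmem m N hm)
      linarith
    obtain ⟨c, hc⟩ := cauchySeq_tendsto_of_complete hcau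
    refine ⟨c, tendsto_nhds_unique ((hf.tendsto c).comp hc) ?_⟩
    simpa only [Function.comp_def, hb] using hx

lemma exists_scheme_image {γ : Type*} [TopologicalSpace γ] [PolishSpace γ] {X : Set γ}
    (hX : IsClosed X) {f : γ → Cantor} (hf : Continuous f) (hinj : Function.Injective f) :
    ∃ V : ℕ → ℕ → Set Cantor, (∀ n k, MeasurableSet (V n k)) ∧ (∀ n, f '' X ⊆ ⋃ k, V n k) ∧
      ∀ (k : ℕ → ℕ) (y : ℕ → Cantor) (x : Cantor), (∀ n, ∀ j ≤ n, y n ∈ V j (k j)) →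
        Tendsto y atTop (𝓝 x) → x ∈ f '' X := by
  have := hX.polishSpace
  have h := exists_scheme_range (hf.comp (continuous_subtype_val (p := (· ∈ X))))
    (hinj.comp Subtype.val_injective)
  rwa [range_comp, Subtype.range_coe] at h

instance : PolishSpace Cantor where
  toIsCompletelyMetrizableSpace := .pi_countable

/-- A Borel set is the result of a Souslin-type scheme of Borel sets. -/
lemma exists_scheme {X : Set Cantor} (hX : MeasurableSet X) :
    ∃ V : ℕ → ℕ → Set Cantor, (∀ n k, MeasurableSet (V n k)) ∧ (∀ n, X ⊆ ⋃ k, V n k) ∧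
      ∀ (k : ℕ → ℕ) (y : ℕ → Cantor) (x : Cantor), (∀ n, ∀ j ≤ n, y n ∈ V j (k j)) →
        Tendsto y atTop (𝓝 x) → x ∈ X := by
  obtain ⟨t, ht, hp, hc, -⟩ := hX.isClopenable
  have := @exists_scheme_image Cantor t hp X hc id (continuous_id_of_le ht) Function.injective_id
  rwa [image_id] at this

/-- Shrinking a non-thin set so that finitely many of its translates each lie in a single set of
a given countable cover. -/
lemma exists_not_thin_subset {V : ℕ → Set Cantor} (hVm : ∀ k, MeasurableSet (V k))
    {A : Set Cantor} (hA : ¬ Thin A) (hAm : MeasurableSet A) (F : Finset (Finset ℕ))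
    (hF : ∀ γ ∈ F, ∀ x ∈ A, flipOn γ x ∈ ⋃ k, V k) :
    ∃ A' ⊆ A, ¬ Thin A' ∧ MeasurableSet A' ∧ ∀ γ ∈ F, ∃ k, ∀ x ∈ A', flipOn γ x ∈ V k := by
  classical
  induction F using Finset.induction_on with
  | empty => exact ⟨A, subset_rfl, hA, hAm, by simp⟩
  | insert γ F _ ih =>
    obtain ⟨A', hA', ht, hm, h⟩ := ih fun γ hγ => hF γ (Finset.mem_insert_of_mem hγ)
    obtain ⟨k, hk⟩ := exists_not_thin_inter (B := fun k => flipOn γ ⁻¹' V k) ht fun x hx => by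
      simpa using hF γ (Finset.mem_insert_self _ _) x (hA' hx)
    refine ⟨_, inter_subset_left.trans hA', hk, hm.inter (measurable_flipOn γ (hVm k)), ?_⟩
    intro δ hδ
    rcases Finset.mem_insert.1 hδ with rfl | hδ
    · exact ⟨k, fun x hx => hx.2⟩
    · obtain ⟨j, hj⟩ := h δ hδ
      exact ⟨j, fun x hx => hj x hx.1⟩

lemma exists_not_thin_cyl {A : Set Cantor} (hA : ¬ Thin A) (M : ℕ) :
    ∃ x, ¬ Thin (A ∩ cyl x M) := by
  have hc : A ⊆ ⋃ s : Fin M → Bool, cyl (fun k => if h : k < M then s ⟨k, h⟩ else false) M := by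
    intro x _
    refine mem_iUnion.2 ⟨fun k => x k, fun k hk => ?_⟩
    simp [hk]
  obtain ⟨s, hs⟩ := exists_not_thin_inter hA hc
  exact ⟨_, hs⟩

lemma exists_canon_subset {X : Set Cantor} (hX : MeasurableSet X) (hXl : E0Large X) :
    ∃ h m, IsCanon h m ∧ ∀ a, h a ∈ X := by
  classical
  obtain ⟨V, hVm, hXV, hV⟩ := exists_scheme hX
  have hthin : ¬ Thin X := fun h => hXl (relSmoothOn_of_thin h)
  obtain ⟨h, m, A, g, G, hf, hA0, -, hR, hG⟩ := fusion
    (P := fun A => ¬ Thin A ∧ MeasurableSet A)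
    (R := fun n G g A => ∀ γ ∈ G ∪ G.image (symmDiff g),
      ∃ k, ∀ x ∈ A, flipOn γ x ∈ V n k ∪ Xᶜ)
    (fun A hA => nonempty_iff_ne_empty.2 fun h => hA.1 ⟨∅, countable_empty, by simp, by simp [h]⟩)
    (A₀ := X) ⟨hthin, hX⟩ (by
      rintro n A G ⟨hA, hAm⟩
      obtain ⟨g, hg, hgA⟩ := exists_not_thin_flipOn hA hAm
      refine ⟨g, hg, fun M => ?_⟩
      obtain ⟨x, hx⟩ := exists_not_thin_cyl hgA M
      obtain ⟨A', hA', ht, hm, hk⟩ := exists_not_thin_subset (V := fun k => V n k ∪ Xᶜ)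
        (fun k => (hVm n k).union hX.compl) hx
        ((hAm.inter (measurable_flipOn g hAm)).inter (isClopen_cyl x M).1.measurableSet)
        (G ∪ G.image (symmDiff g)) (by
          intro γ _ y _
          by_cases hy : flipOn γ y ∈ X
          · exact iUnion_mono (fun _ => subset_union_left) (hXV n hy)
          · exact mem_iUnion.2 ⟨0, Or.inr hy⟩)
      refine ⟨A', ⟨ht, hm⟩, fun y hy => (hA' hy).1.1, fun y hy => (hA' hy).1.2, hk, ?_⟩
      intro y hy z hz k hk
      exact ((hA' hy).2 k hk).trans ((hA' hz).2 k hk).symm)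
  refine ⟨h, m, hf.canon, fun a => ?_⟩
  have hne : ∀ n, ∃ y, flipOn (pat g a n) y ∈ A n := fun n => by
    obtain ⟨y, hy⟩ := closure_nonempty_iff.1 ⟨_, hf.mem_closure a n⟩
    exact ⟨flipOn (pat g a n) y, by simpa using hy⟩
  choose y hy using hne
  choose k hk using fun n => hR n _ (pat_succ_mem (hG a n))
  refine hV k (fun n => y (n + 1)) (h a) (fun n j hj => ?_) ?_
  · have hX' : y (n + 1) ∈ X := by
      have := hf.mem_of_le (Nat.zero_le _) (hy (n + 1))
      rwa [hA0, pat, flipOn_empty] at this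
    have := hk j _ (hf.mem_of_le (Nat.succ_le_succ hj) (hy (n + 1)))
    rw [flipOn_flipOn_self] at this
    exact this.resolve_right fun h => h hX'
  · rw [tendsto_pi_nhds]
    intro i
    refine tendsto_const_nhds.congr' ?_
    filter_upwards [eventually_ge_atTop i] with n hn
    exact (hf.agree a (n + 1) _ (hy (n + 1)) i
      ((Nat.lt_succ_of_le hn).trans_le (hf.canon.mono.id_le (n + 1)))).symm

/-! ### Category arguments -/

lemma exists_isOpen_dense_seq {α : Type*} [TopologicalSpace α] [BaireSpace α] {S : Set α}
    (hS : S ∈ residual α) :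
    ∃ D : ℕ → Set α, (∀ n, IsOpen (D n)) ∧ (∀ n, Dense (D n)) ∧ ⋂ n, D n ⊆ S := by
  obtain ⟨t, htS, ht, htd⟩ := mem_residual.1 hS
  obtain ⟨D, hD, rfl⟩ := isGδ_iff_eq_iInter_nat.1 ht
  exact ⟨D, hD, fun n => htd.mono (iInter_subset D n), htS⟩

lemma eventually_residual_fiber {S : Set (Cantor × Cantor)} (hS : S ∈ residual (Cantor × Cantor)) :
    ∀ᶠ x in residual Cantor, ∀ᶠ y in residual Cantor, (x, y) ∈ S := by
  obtain ⟨D, hD, hDd, hDS⟩ := exists_isOpen_dense_seq hS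
  obtain ⟨b, hbc, hbne, hb⟩ := TopologicalSpace.exists_countable_basis Cantor
  have key : ∀ᶠ x in residual Cantor, ∀ n, ∀ u ∈ b, ∃ y ∈ u, (x, y) ∈ D n := by
    refine eventually_countable_forall.2 fun n => (eventually_countable_ball hbc).2 fun u hu => ?_
    have hu' := hb.isOpen hu
    refine residual_of_dense_open (s := {x | ∃ y ∈ u, (x, y) ∈ D n}) ?_ ?_
    · have : {x | ∃ y ∈ u, (x, y) ∈ D n} = Prod.fst '' (Prod.snd ⁻¹' u ∩ D n) := by
        ext x
        simp
      rw [this]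
      exact isOpenMap_fst _ ((hu'.preimage continuous_snd).inter (hD n))
    · refine dense_iff_inter_open.2 fun v hv hvne => ?_
      have hune : u.Nonempty := nonempty_iff_ne_empty.2 fun h => hbne (h ▸ hu)
      obtain ⟨⟨x, y⟩, hxy, hxy'⟩ :=
        (hDd n).inter_open_nonempty _ (hv.prod hu') (hvne.prod hune)
      exact ⟨x, hxy.1, y, hxy.2, hxy'⟩
  filter_upwards [key] with x hx
  have h : ∀ᶠ y in residual Cantor, ∀ n, (x, y) ∈ D n := by
    refine eventually_countable_forall.2 fun n => ?_
    refine residual_of_dense_open (s := {y | (x, y) ∈ D n})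
      ((hD n).preimage (Continuous.prodMk_right x)) (hb.dense_iff.2 fun u hu _ => ?_)
    obtain ⟨y, hy, hy'⟩ := hx n u hu
    exact ⟨y, hy, hy'⟩
  filter_upwards [h] with y hy
  exact hDS (mem_iInter.2 hy)

lemma exists_flipOn_mem {A : Set Cantor} (hA : IsOpen A) (hne : A.Nonempty) :
    ∃ g : Finset ℕ, g.Nonempty ∧ (A ∩ flipOn g ⁻¹' A).Nonempty := by
  obtain ⟨x, hx⟩ := hne
  obtain ⟨n, hn⟩ := exists_cyl_subset hA hx
  refine ⟨{n}, Finset.singleton_nonempty n, x, hx, hn fun k hk => flipOn_of_notMem ?_ x⟩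
  simpa using hk.ne

/-- A canonical embedding into a comeagre set `C`, whose modifications `g n` are controlled by
the open sets `O`. -/
lemma fusion_residual {A₀ C : Set Cantor} (hA₀ : IsOpen A₀) (hne : A₀.Nonempty)
    (hC : C ∈ residual Cantor) {O : Finset ℕ → Set Cantor} (hO : ∀ g, IsOpen (O g))
    (hex : ∀ A ⊆ A₀, IsOpen A → A.Nonempty →
      ∃ g : Finset ℕ, g.Nonempty ∧ (A ∩ flipOn g ⁻¹' A ∩ O g).Nonempty) :
    ∃ h m A g, IsFusion h m A g ∧ (∀ a, h a ∈ C) ∧ (∀ a, h a ∈ A₀) ∧ (∀ n, IsClosed (A n)) ∧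
      ∀ n, A (n + 1) ⊆ O (g n) := by
  obtain ⟨D, hD, hDd, hDC⟩ := exists_isOpen_dense_seq hC
  obtain ⟨x₀, hx₀⟩ := hne
  obtain ⟨N₀, hN₀⟩ := exists_cyl_subset hA₀ hx₀
  obtain ⟨h, m, A, g, G, hf, hA0, hP, hR, hG⟩ := fusion
    (P := fun A => IsClopen A ∧ A.Nonempty ∧ A ⊆ A₀)
    (R := fun n G g A => A ⊆ O g ∧ ∀ γ ∈ G ∪ G.image (symmDiff g), ∀ z ∈ A, flipOn γ z ∈ D n)
    (fun A hA => hA.2.1) (A₀ := cyl x₀ N₀) ⟨isClopen_cyl _ _, ⟨x₀, mem_cyl_self _ _⟩, hN₀⟩ (by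
      rintro n A G ⟨hA, hAne, hAA₀⟩
      obtain ⟨g, hg, hgne⟩ := hex A hAA₀ hA.2 hAne
      refine ⟨g, hg, fun M => ?_⟩
      have hB : IsOpen (A ∩ flipOn g ⁻¹' A ∩ O g) :=
        (hA.2.inter (hA.2.preimage (continuous_flipOn g))).inter (hO g)
      have hF : IsOpen (⋂ γ ∈ G ∪ G.image (symmDiff g), flipOn γ ⁻¹' D n) :=
        isOpen_biInter_finset fun γ _ => (hD n).preimage (continuous_flipOn γ)
      have hFd : Dense (⋂ γ ∈ G ∪ G.image (symmDiff g), flipOn γ ⁻¹' D n) :=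
        dense_of_mem_residual <| (Filter.biInter_finset_mem _).2 fun γ _ =>
          residual_of_dense_open ((hD n).preimage (continuous_flipOn γ))
            ((hDd n).preimage (flipHomeo γ).isOpenMap)
      obtain ⟨x, hxB, hxF⟩ := hFd.inter_open_nonempty _ hB hgne
      obtain ⟨N, hN⟩ := exists_cyl_subset (hB.inter hF) ⟨hxB, hxF⟩
      have hsub := (cyl_anti x (le_max_left N M)).trans hN
      refine ⟨cyl x (max N M), ⟨isClopen_cyl _ _, ⟨x, mem_cyl_self _ _⟩, fun y hy =>
        hAA₀ (hsub hy).1.1.1⟩, fun y hy => (hsub hy).1.1.1, fun y hy => (hsub hy).1.1.2,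
        ⟨fun y hy => (hsub hy).1.2, fun γ hγ y hy => mem_iInter₂.1 (hsub hy).2 γ hγ⟩, ?_⟩
      intro y hy z hz k hk
      have hk' := hk.trans_le (le_max_right N M)
      exact (hy k hk').trans (hz k hk').symm)
  have hmem : ∀ a n, flipOn (pat g a n) (h a) ∈ A n := fun a n =>
    (hP n).1.1.closure_subset (hf.mem_closure a n)
  refine ⟨h, m, A, g, hf, fun a => hDC (mem_iInter.2 fun n => ?_), fun a => ?_,
    fun n => (hP n).1.1, fun n => (hR n).1⟩
  · simpa using (hR n).2 _ (pat_succ_mem (hG a n)) _ (hmem a (n + 1))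
  · simpa [pat] using (hP 0).2.2 (hmem a 0)

/-- A canonical embedding all of whose `E₀`-inequivalent values are mutually generic. -/
lemma exists_canon_residual_prod {W : Set (Cantor × Cantor)}
    (hW : W ∈ residual (Cantor × Cantor)) :
    ∃ h m, IsCanon h m ∧ ∀ a b, ¬ eZero a b → (h a, h b) ∈ W := by
  obtain ⟨D, hD, hDd, hDW⟩ := exists_isOpen_dense_seq hW
  have hcont : ∀ γ γ' : Finset ℕ, Continuous fun p : Cantor × Cantor =>
      (flipOn γ p.1, flipOn γ' p.2) := fun γ γ' =>
    ((continuous_flipOn γ).comp continuous_fst).prodMk ((continuous_flipOn γ').comp continuous_snd)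
  have hopen : ∀ γ γ' : Finset ℕ, IsOpenMap fun p : Cantor × Cantor =>
      (flipOn γ p.1, flipOn γ' p.2) := fun γ γ' =>
    ((flipHomeo γ).prodCongr (flipHomeo γ')).isOpenMap
  let T : ℕ → Finset ℕ → Finset ℕ → Set (Cantor × Cantor) := fun n γ γ' =>
    ⋂ i ∈ Finset.range (n + 1), {p | (flipOn γ p.1, flipOn γ' p.2) ∈ D i} ∩
      {p | (flipOn γ' p.2, flipOn γ p.1) ∈ D i}
  have hT : ∀ n γ γ', IsOpen (T n γ γ') := fun n γ γ' =>
    isOpen_biInter_finset fun i _ => ((hD i).preimage (hcont γ γ')).inter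
      ((hD i).preimage (continuous_swap.comp (hcont γ γ')))
  have hTr : ∀ n γ γ', T n γ γ' ∈ residual (Cantor × Cantor) := fun n γ γ' =>
    (Filter.biInter_finset_mem _).2 fun i _ => inter_mem
      (residual_of_dense_open ((hD i).preimage (hcont γ γ')) ((hDd i).preimage (hopen γ γ')))
      (residual_of_dense_open ((hD i).preimage (continuous_swap.comp (hcont γ γ')))
        ((hDd i).preimage ((Homeomorph.prodComm Cantor Cantor).isOpenMap.comp (hopen γ γ'))))
  obtain ⟨h, m, A, g, G, hf, -, hP, hR, hG⟩ := fusion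
    (P := fun A => IsClopen A ∧ A.Nonempty)
    (R := fun n G g A => ∀ γ ∈ G, ∀ γ' ∈ G, ∀ z ∈ A, ∀ w ∈ A, (z, flipOn g w) ∈ T n γ γ')
    (fun A hA => hA.2) (A₀ := univ) ⟨isClopen_univ, univ_nonempty⟩ (by
      rintro n A G ⟨hA, hAne⟩
      have hF : IsOpen (⋂ q ∈ G ×ˢ G, T n q.1 q.2) := isOpen_biInter_finset fun q _ => hT n _ _
      have hFd : Dense (⋂ q ∈ G ×ˢ G, T n q.1 q.2) :=
        dense_of_mem_residual <| (Filter.biInter_finset_mem _).2 fun q _ => hTr n _ _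
      obtain ⟨g₀, hg₀, x₀, hx₀, hx₀'⟩ := exists_flipOn_mem hA.2 hAne
      have hB : IsOpen (A ×ˢ A ∩ {p : Cantor × Cantor | p.1 ≠ p.2}) :=
        (hA.2.prod hA.2).inter (isOpen_ne_fun continuous_fst continuous_snd)
      obtain ⟨⟨x, y⟩, hxyB, hxyF⟩ := hFd.inter_open_nonempty _ hB
        ⟨(x₀, flipOn g₀ x₀), ⟨hx₀, hx₀'⟩, (flipOn_ne hg₀ x₀).symm⟩
      obtain ⟨u, v, hu, hv, hxu, hyv, huv⟩ := isOpen_prod_iff.1 (hB.inter hF) x y ⟨hxyB, hxyF⟩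
      obtain ⟨N₁, hN₁⟩ := exists_cyl_subset hu hxu
      obtain ⟨N₂, hN₂⟩ := exists_cyl_subset hv hyv
      obtain ⟨N₃, hN₃⟩ := Function.ne_iff.1 hxyB.2
      let N := max (max N₁ N₂) (N₃ + 1)
      let g := (Finset.range N).filter fun k => x k ≠ y k
      have hgy : ∀ z ∈ cyl x N, flipOn g z ∈ cyl y N := by
        intro z hz k hk
        by_cases hxy : x k = y k
        · rw [flipOn_of_notMem (by simp [g, hxy]), hz k hk, hxy]
        · rw [flipOn_of_mem (by simp [g, hxy, hk]), hz k hk]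
          cases hx : x k <;> cases hy : y k <;> simp_all
      have hN1 : N₁ ≤ N := (le_max_left _ _).trans (le_max_left _ _)
      have hN2 : N₂ ≤ N := (le_max_right _ _).trans (le_max_left _ _)
      have hsub : ∀ z ∈ cyl x N, ∀ w ∈ cyl x N, (z, flipOn g w) ∈
          (A ×ˢ A ∩ {p : Cantor × Cantor | p.1 ≠ p.2}) ∩ ⋂ q ∈ G ×ˢ G, T n q.1 q.2 :=
        fun z hz w hw => huv ⟨hN₁ (cyl_anti x hN1 hz), hN₂ (cyl_anti y hN2 (hgy w hw))⟩
      refine ⟨g, ⟨N₃, ?_⟩, fun M => ⟨cyl x (max N M), ⟨isClopen_cyl _ _, x, mem_cyl_self _ _⟩,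
        ?_, ?_, ?_, ?_⟩⟩
      · exact Finset.mem_filter.2 ⟨Finset.mem_range.2 (Nat.lt_of_succ_le (le_max_right _ _)), hN₃⟩
      · intro z hz
        have hz' := cyl_anti x (le_max_left N M) hz
        exact (hsub z hz' z hz').1.1.1
      · intro z hz
        have hz' := cyl_anti x (le_max_left N M) hz
        exact (hsub z hz' z hz').1.1.2
      · intro γ hγ γ' hγ' z hz w hw
        exact mem_iInter₂.1 (hsub z (cyl_anti x (le_max_left N M) hz) w
          (cyl_anti x (le_max_left N M) hw)).2 (γ, γ') (Finset.mk_mem_product hγ hγ')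
      · intro z hz w hw k hk
        have hk' := hk.trans_le (le_max_right N M)
        exact (hz k hk').trans (hw k hk').symm)
  have hmem : ∀ a n, flipOn (pat g a n) (h a) ∈ A n := fun a n =>
    (hP n).1.1.closure_subset (hf.mem_closure a n)
  have key : ∀ a b n, a n = false → b n = true → ∀ i ≤ n,
      (h a, h b) ∈ D i ∧ (h b, h a) ∈ D i := by
    intro a b n ha hb i hi
    have := mem_iInter₂.1 (hR n _ (hG a n) _ (hG b n) _ (hmem a (n + 1)) _ (hmem b (n + 1))) i
      (Finset.mem_range.2 (Nat.lt_succ_of_le hi))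
    rw [pat_succ_of_false ha, pat_succ_of_true hb, flipOn_symmDiff, flipOn_flipOn_self] at this
    simpa using this
  refine ⟨h, m, hf.canon, fun a b hab => hDW (mem_iInter.2 fun i => ?_)⟩
  obtain ⟨n, hn, hne⟩ : ∃ n, i ≤ n ∧ a n ≠ b n := by
    by_contra! hcon
    exact hab (eZero_iff_eventually.2 ⟨i, hcon⟩)
  cases ha : a n <;> cases hb : b n
  · exact absurd (ha.trans hb.symm) hne
  · exact (key a b n ha hb i hn).1
  · exact (key b a n hb ha i hn).2
  · exact absurd (ha.trans hb.symm) hne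

/-! ### Canonization on the whole space -/

variable {E : Cantor → Cantor → Prop}

lemma exists_canon_of_le_eZero (hE : Equivalence E)
    (hEB : MeasurableSet {p : Cantor × Cantor | E p.1 p.2}) (hle : ∀ x y, E x y → eZero x y) :
    ∃ h m, IsCanon h m ∧ ((∀ a b, E (h a) (h b) ↔ eZero a b) ∨ ∀ a b, E (h a) (h b) ↔ a = b) := by
  have hEg : ∀ g, MeasurableSet {z | E z (flipOn g z)} := fun g =>
    hEB.preimage (measurable_id.prodMk (measurable_flipOn g))
  choose O hO hEO using fun g => (hEg g).residualEq_isOpen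
  have hC : ∀ᶠ x in residual Cantor, ∀ γ g,
      E (flipOn γ x) (flipOn g (flipOn γ x)) ↔ flipOn γ x ∈ O g :=
    eventually_countable_forall.2 fun γ => eventually_countable_forall.2 fun g =>
      (tendsto_residual_of_isOpenMap (continuous_flipOn γ) (flipHomeo γ).isOpenMap).eventually
        (hEO g).mem_iff
  by_cases H : ∀ A : Set Cantor, IsOpen A → A.Nonempty →
      ∃ g : Finset ℕ, g.Nonempty ∧ (A ∩ flipOn g ⁻¹' A ∩ O g).Nonempty
  · obtain ⟨h, m, A, g, hf, hhC, -, hAc, hAO⟩ :=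
      fusion_residual isOpen_univ univ_nonempty hC hO fun A _ => H A
    have key : ∀ a n, E (h a) (flipOn (pat g a n) (h a)) := by
      intro a n
      induction n with
      | zero => simpa [pat] using hE.refl (h a)
      | succ n ih =>
        cases ha : a n
        · rwa [pat_succ_of_false ha]
        · refine hE.trans ih (hE.symm ?_)
          have h1 := (hhC a (pat g a (n + 1)) (g n)).2
            (hAO n ((hAc (n + 1)).closure_subset (hf.mem_closure a (n + 1))))
          rw [pat_succ_of_true ha, flipOn_symmDiff] at h1 ⊢
          rwa [flipOn_flipOn_self] at h1
    refine ⟨h, m, hf.canon, Or.inl fun a b =>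
      ⟨fun hab => (hf.canon.eZero_iff a b).1 (hle _ _ hab), fun hab => ?_⟩⟩
    obtain ⟨n, hn⟩ := eZero_iff_eventually.1 hab
    have := key a n
    rw [hf.tail a b n hn] at this
    exact hE.trans this (hE.symm (key b n))
  · push Not at H
    obtain ⟨A₀, hA₀, hne, hA₀O⟩ := H
    obtain ⟨h, m, A, g, hf, hhC, hhA, -, -⟩ :=
      fusion_residual hA₀ hne hC (O := fun _ => univ) (fun _ => isOpen_univ) fun A _ hA hA' => by
        simpa using exists_flipOn_mem hA hA'
    refine ⟨h, m, hf.canon, Or.inr fun a b => ⟨fun hab => hf.canon.injective ?_, ?_⟩⟩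
    · obtain ⟨γ, hγ⟩ := eZero_iff_flipOn.1 (hle _ _ hab)
      rcases γ.eq_empty_or_nonempty with rfl | hγne
      · simpa using hγ.symm
      · rw [hγ] at hab
        have hO' := (hhC a ∅ γ).1 (by simpa using hab)
        have hmem : h a ∈ A₀ ∩ flipOn γ ⁻¹' A₀ ∩ O γ :=
          ⟨⟨hhA a, by simpa [← hγ] using hhA b⟩, by simpa using hO'⟩
        rw [hA₀O γ hγne] at hmem
        exact hmem.elim
    · rintro rfl
      exact hE.refl _

lemma IsCanon.measurableSet_pullback {h : Cantor → Cantor} {m : ℕ → ℕ} (H : IsCanon h m)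
    (hEB : MeasurableSet {p : Cantor × Cantor | E p.1 p.2}) :
    MeasurableSet {p : Cantor × Cantor | E (h p.1) (h p.2)} :=
  hEB.preimage (H.continuous.measurable.prodMap H.continuous.measurable)

lemma exists_canon_canonization (hE : Equivalence E)
    (hEB : MeasurableSet {p : Cantor × Cantor | E p.1 p.2}) :
    ∃ h m, IsCanon h m ∧ ((∀ a b, E (h a) (h b)) ∨ (∀ a b, E (h a) (h b) ↔ eZero a b) ∨
      ∀ a b, E (h a) (h b) ↔ a = b) := by
  obtain ⟨u, hu, hEu⟩ := hEB.residualEq_isOpen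
  rcases u.eq_empty_or_nonempty with rfl | ⟨⟨x, y⟩, hxy⟩
  · obtain ⟨h₁, m₁, H₁, hW⟩ := exists_canon_residual_prod (W := {p | ¬ E p.1 p.2}) (by
      filter_upwards [hEu.mem_iff] with p hp hEp
      exact hp.1 hEp)
    obtain ⟨h, m, H, hh⟩ := exists_canon_of_le_eZero (hE.comap h₁)
      (H₁.measurableSet_pullback hEB) fun a b hab => by_contra fun h => hW a b h hab
    exact ⟨h₁ ∘ h, m₁ ∘ m, H₁.comp H, Or.inr hh⟩
  · obtain ⟨A, B, hA, hB, hxA, hyB, hAB⟩ := isOpen_prod_iff.1 hu x y hxy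
    have hS := eventually_residual_fiber (S := {p | E p.1 p.2 ↔ p ∈ u}) hEu.mem_iff
    obtain ⟨h, m, A', g, hf, hhS, hhA, -⟩ :=
      fusion_residual hA ⟨x, hxA⟩ hS (O := fun _ => univ) (fun _ => isOpen_univ)
        fun A _ hA hA' => by simpa using exists_flipOn_mem hA hA'
    refine ⟨h, m, hf.canon, Or.inl fun a b => ?_⟩
    obtain ⟨z, hzB, hza, hzb⟩ := (dense_of_mem_residual
      (inter_mem (hhS a) (hhS b))).inter_open_nonempty B hB ⟨y, hyB⟩
    exact hE.trans (hza.2 (hAB ⟨hhA a, hzB⟩)) (hE.symm (hzb.2 (hAB ⟨hhA b, hzB⟩)))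

end Canonization

/-- Canonization of Borel equivalence relations on `E₀`-large sets: on some canonical
`E₀`-large subset, `E` coincides with the total relation, with `E₀`, or with equality;
if `E` is countable, case (I) is impossible, and if `E₀ ⊆ E`, case (III) is impossible. -/
theorem e0_canonization (E : Cantor → Cantor → Prop) (hE : Equivalence E)
    (hEB : MeasurableSet {p : Cantor × Cantor | E p.1 p.2})
    (X : Set Cantor) (hX : MeasurableSet X) (hXl : E0Large X) :
    (∃ U : E0Array, Du U ⊆ X ∧
       ((∀ x ∈ Du U, ∀ y ∈ Du U, E x y) ∨
        (∀ x ∈ Du U, ∀ y ∈ Du U, (E x y ↔ eZero x y)) ∨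
        (∀ x ∈ Du U, ∀ y ∈ Du U, (E x y ↔ x = y)))) ∧
    ((∀ x, {y | E x y}.Countable) →
      ∃ U : E0Array, Du U ⊆ X ∧
        ((∀ x ∈ Du U, ∀ y ∈ Du U, (E x y ↔ eZero x y)) ∨
         (∀ x ∈ Du U, ∀ y ∈ Du U, (E x y ↔ x = y)))) ∧
    ((∀ x y, eZero x y → E x y) →
      ∃ U : E0Array, Du U ⊆ X ∧
        ((∀ x ∈ Du U, ∀ y ∈ Du U, E x y) ∨
         (∀ x ∈ Du U, ∀ y ∈ Du U, (E x y ↔ eZero x y)))) := by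
  obtain ⟨h₁, m₁, H₁, hX₁⟩ := exists_canon_subset hX hXl
  obtain ⟨h₂, m₂, H₂, hh₂⟩ := exists_canon_canonization
    (hE.comap h₁) (H₁.measurableSet_pullback hEB)
  have H := H₁.comp H₂
  obtain ⟨U, hU⟩ := H.exists_array
  have hDu : Du U = Set.range (h₁ ∘ h₂) := by rw [Du, hU]
  have hUX : Du U ⊆ X := by
    rw [hDu]
    rintro _ ⟨a, rfl⟩
    exact hX₁ _
  have main : (∀ a b, E ((h₁ ∘ h₂) a) ((h₁ ∘ h₂) b)) ∨
      (∀ x ∈ Du U, ∀ y ∈ Du U, (E x y ↔ eZero x y)) ∨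
      (∀ a b, E ((h₁ ∘ h₂) a) ((h₁ ∘ h₂) b) ↔ a = b) := by
    refine hh₂.imp id (Or.imp (fun hII => ?_) id)
    rw [hDu]
    rintro _ ⟨a, rfl⟩ _ ⟨b, rfl⟩
    exact (hII a b).trans (H.eZero_iff a b).symm
  have total : (∀ a b, E ((h₁ ∘ h₂) a) ((h₁ ∘ h₂) b)) → ∀ x ∈ Du U, ∀ y ∈ Du U, E x y := by
    rw [hDu]
    rintro h _ ⟨a, rfl⟩ _ ⟨b, rfl⟩
    exact h a b
  have equality : (∀ a b, E ((h₁ ∘ h₂) a) ((h₁ ∘ h₂) b) ↔ a = b) →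
      ∀ x ∈ Du U, ∀ y ∈ Du U, (E x y ↔ x = y) := by
    rw [hDu]
    rintro h _ ⟨a, rfl⟩ _ ⟨b, rfl⟩
    exact (h a b).trans H.injective.eq_iff.symm
  refine ⟨⟨U, hUX, main.imp total (Or.imp id equality)⟩, fun hc => ⟨U, hUX, ?_⟩,
    fun hle => ⟨U, hUX, ?_⟩⟩
  · refine (main.resolve_left fun h => ?_).imp id equality
    have : (Set.univ : Set Cantor).Countable :=
      Set.MapsTo.countable_of_injOn (f := h₁ ∘ h₂) (fun b _ => h (fun _ => false) b)
        H.injective.injOn (hc _)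
    have : Countable Cantor := Set.countable_univ_iff.1 this
    obtain ⟨f, hf⟩ := exists_surjective_nat Cantor
    obtain ⟨n, hn⟩ := hf fun k => !(f k k)
    simpa using congrFun hn n
  · rcases main with h | h | h
    · exact Or.inl (total h)
    · exact Or.inr h
    · let a : Cantor := fun _ => false
      have hab : eZero a (flipOn {0} a) := eZero_iff_flipOn.2 ⟨_, rfl⟩
      exact absurd ((h _ _).1 (hle _ _ ((H.eZero_iff _ _).2 hab))).symm
        (flipOn_ne (Finset.singleton_nonempty 0) a)
end
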